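/- arXiv:1706.05558 — 3 statements merged into one kernel-verified Lean document; each statement's English description precedes it below -/
import Mathlib

section
/- Let I be a countable, locally finite structure in a language L' containing a binary relation < that linearly orders I. Then I-indexed indiscernible sets have the modeling property if and only if age(I) has the Ramsey property. (In particular, no assumption that complete quantifier-free types in I are isolated by quantifier-free formulas is needed for either direction.) -/
open FirstOrder FirstOrder.Language FirstOrder.Language.Structure CategoryTheory

namespace SRPaper

/-- Two tuples from `M` have the same complete quantifier-free type:
they satisfy the same quantifier-free formulas. -/
def SameQfTp (L : Language) (M : Type*) [L.Structure M] {n : ℕ} (a b : Fin n → M) : Prop :=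
  ∀ φ : L.Formula (Fin n), φ.IsQF → (φ.Realize a ↔ φ.Realize b)

/-- A map is quantifier-free-type-preserving if tuples with the same complete
quantifier-free type are sent to tuples with the same complete quantifier-free type. -/
def QfTpPreserving (LA : Language) (A : Type*) [LA.Structure A]
    (LB : Language) (B : Type*) [LB.Structure B] (h : A → B) : Prop :=
  ∀ (n : ℕ) (a b : Fin n → A), SameQfTp LA A a b → SameQfTp LB B (h ∘ a) (h ∘ b)

/-- `g : A → B` and `f : B → A` witness that `A` is a semi-retraction of `B`. -/
def SemiRetractionWitness (LA : Language) (A : Type*) [LA.Structure A]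
    (LB : Language) (B : Type*) [LB.Structure B] (g : A → B) (f : B → A) : Prop :=
  Function.Injective g ∧ Function.Injective f ∧
    QfTpPreserving LA A LB B g ∧ QfTpPreserving LB B LA A f ∧
    ∀ (n : ℕ) (φ : LA.Formula (Fin n)), φ.IsQF →
      ∀ s : Fin n → A, φ.Realize s → φ.Realize (f ∘ g ∘ s)

/-- `A` is a semi-retraction of `B`. -/
def IsSemiRetractionOf (LA : Language) (A : Type*) [LA.Structure A]
    (LB : Language) (B : Type*) [LB.Structure B] : Prop :=
  ∃ (g : A → B) (f : B → A), SemiRetractionWitness LA A LB B g f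

/-- The Ramsey property for a class of structures `K`: for all `A B ∈ K` and `k ≥ 1` there is
`C ∈ K` such that every `k`-coloring of substructures of `C` admits a copy `B'` of `B` in `C`
on which the color of copies of `A` is constant. -/
def RamseyClass (L : Language) (K : Set (Bundled L.Structure)) : Prop :=
  ∀ A B : Bundled L.Structure, A ∈ K → B ∈ K → ∀ k : ℕ, 1 ≤ k →
    ∃ C : Bundled L.Structure, C ∈ K ∧
      ∀ c : L.Substructure C → Fin k,
        ∃ B' : L.Substructure C, Nonempty (B ≃[L] B') ∧
          ∀ A₁ A₂ : L.Substructure C, A₁ ≤ B' → A₂ ≤ B' →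
            Nonempty (A ≃[L] A₁) → Nonempty (A ≃[L] A₂) → c A₁ = c A₂

/-- A countable structure has the Ramsey property if its age does. -/
def HasRP (L : Language) (M : Type*) [L.Structure M] : Prop :=
  RamseyClass L (L.age M)

/-- `(a i : i ∈ I)` is an `I`-indexed indiscernible set of `d`-tuples in `U`. -/
def IndexedIndiscernible (L' : Language) (I : Type*) [L'.Structure I]
    (L : Language) (U : Type*) [L.Structure U] (d : ℕ) (a : I → Fin d → U) : Prop :=
  ∀ (n : ℕ) (ι κ : Fin n → I), SameQfTp L' I ι κ →
    ∀ φ : L.Formula (Fin n × Fin d),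
      (φ.Realize fun p => a (ι p.1) p.2) ↔ (φ.Realize fun p => a (κ p.1) p.2)

/-- `Y` realizes the EM-type of `X`: any formula satisfied by all `X`-tuples whose index tuple
has a given complete quantifier-free type in `I` is satisfied by the corresponding `Y`-tuple. -/
def LocallyBased (L' : Language) (I : Type*) [L'.Structure I]
    (L : Language) (U : Type*) [L.Structure U] (d : ℕ) (X Y : I → Fin d → U) : Prop :=
  ∀ (n : ℕ) (φ : L.Formula (Fin n × Fin d)) (ι : Fin n → I),
    (∀ κ : Fin n → I, SameQfTp L' I ι κ → φ.Realize fun p => X (κ p.1) p.2) →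
    (φ.Realize fun p => Y (ι p.1) p.2)

/-- `U` realizes every finitely-satisfiable set of formulas in one free variable with
countably many parameters: "sufficient saturation" for countable index structures. -/
def AlephOneSaturated (L : Language) (U : Type*) [L.Structure U] : Prop :=
  ∀ (p : ℕ → U) (Φ : Set (L.Formula (ℕ ⊕ Fin 1))),
    (∀ Φ₀ : Finset (L.Formula (ℕ ⊕ Fin 1)), ↑Φ₀ ⊆ Φ →
      ∃ x : U, ∀ φ ∈ Φ₀, Formula.Realize φ (Sum.elim p fun _ => x)) →
    ∃ x : U, ∀ φ ∈ Φ, Formula.Realize φ (Sum.elim p fun _ => x)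

/-- `I`-indexed indiscernible sets have the modeling property: in any sufficiently saturated
structure `U`, any `I`-indexed set of same-length tuples admits an `I`-indexed indiscernible
set in `U` locally based on it. -/
def ModelingProperty (L' : Language) (I : Type*) [L'.Structure I] : Prop :=
  ∀ (L : FirstOrder.Language.{0, 0}) (U : Type) [L.Structure U], AlephOneSaturated L U →
    ∀ (d : ℕ) (X : I → Fin d → U),
      ∃ Y : I → Fin d → U,
        IndexedIndiscernible L' I L U d Y ∧ LocallyBased L' I L U d X Y

end SRPaper

namespace SRPaper

theorem exists_emb_of_same {L : Language} {M : Type*} [L.Structure M] {n : ℕ} {a b : Fin n → M}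
    (h : SameQfTp L M a b) :
    ∃ e : Substructure.closure L (Set.range a) ↪[L] M,
      ∀ j, e ⟨a j, Substructure.subset_closure ⟨j, rfl⟩⟩ = b j := by
  have hterm : ∀ x : Substructure.closure L (Set.range a), ∃ t : L.Term (Fin n),
      t.realize a = (x : M) := by
    rintro ⟨x, hx⟩
    obtain ⟨t, ht⟩ := Substructure.mem_closure_iff_exists_term.1 hx
    refine ⟨t.relabel (fun y => y.2.choose), ?_⟩
    rw [Term.realize_relabel]
    refine Eq.trans ?_ ht
    congr 1
    funext y
    exact y.2.choose_spec
  choose t ht using hterm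
  have heq : ∀ s s' : L.Term (Fin n), s.realize a = s'.realize a ↔ s.realize b = s'.realize b := by
    intro s s'
    have := h (s.equal s') ((BoundedFormula.IsAtomic.equal _ _).isQF)
    simpa using this
  refine ⟨⟨⟨fun x => (t x).realize b, ?_⟩, ?_, ?_⟩, ?_⟩
  · intro x y hxy
    have := (heq _ _).2 hxy
    rw [ht, ht] at this
    exact Subtype.ext this
  · intro m f x
    have : (t (funMap f x)).realize a = (Term.func f (fun i => t (x i))).realize a := by
      rw [ht]
      simp only [Term.realize, ht]
      rfl
    exact (heq _ _).1 this
  · intro m r x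
    have := h (r.formula (fun i => t (x i))) ((BoundedFormula.IsAtomic.rel _ _).isQF)
    simp only [Formula.realize_rel, ht] at this
    exact this.symm
  · intro j
    have := (heq (t ⟨a j, Substructure.subset_closure ⟨j, rfl⟩⟩) (Term.var j)).1 (by rw [ht]; rfl)
    exact this

theorem same_of_emb {L : Language} {M N : Type*} [L.Structure M] [L.Structure N]
    (e e' : N ↪[L] M) {n : ℕ} (a : Fin n → N) :
    SameQfTp L M (e ∘ a) (e' ∘ a) := by
  intro φ hφ
  have h1 := hφ.realize_embedding e (v := a) (xs := default)
  have h2 := hφ.realize_embedding e' (v := a) (xs := default)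
  simp only [Formula.Realize]
  rw [Subsingleton.elim (default : Fin 0 → M) (e ∘ default), h1,
    ← h2, Subsingleton.elim (e' ∘ default) (e ∘ default)]

theorem realize_congr {L : Language} {M : Type*} [L.Structure M] {α : Type*} [DecidableEq α]
    (φ : L.Formula α) {v w : α → M} (h : ∀ i ∈ φ.freeVarFinset, v i = w i) :
    φ.Realize v ↔ φ.Realize w := by
  have h1 := BoundedFormula.realize_restrictFreeVar (φ := φ) (f := fun i => i)
    (v := fun i => v i) (v' := v) (xs := default) (fun a => rfl)
  have h2 := BoundedFormula.realize_restrictFreeVar (φ := φ) (f := fun i => i)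
    (v := fun i => v i) (v' := w) (xs := default) (fun a => h _ a.2)
  exact h1.symm.trans h2

theorem exists_ex_formula {L : Language} {U : Type*} [L.Structure U] [Nonempty U]
    (Φ : Finset (L.Formula ℕ)) (n : ℕ) :
    ∃ ψ : L.Formula (ℕ ⊕ Fin 1), ∀ (v : ℕ → U) (x : U),
      ψ.Realize (Sum.elim v fun _ => x) ↔
        ∃ w : ℕ → U, (∀ i < n, w i = v i) ∧ w n = x ∧ ∀ φ ∈ Φ, φ.Realize w := by
  classical
  obtain ⟨N, hN⟩ : ∃ N : ℕ, ∀ φ ∈ Φ, ∀ i ∈ φ.freeVarFinset, i < N := by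
    refine ⟨((Φ.biUnion fun φ => φ.freeVarFinset).sup id) + 1, fun φ hφ i hi => ?_⟩
    have : i ≤ (Φ.biUnion fun φ => φ.freeVarFinset).sup id :=
      Finset.le_sup (f := id) (Finset.mem_biUnion.2 ⟨φ, hφ, hi⟩)
    omega
  let g : ℕ → (ℕ ⊕ Fin 1) ⊕ Fin N := fun i =>
    if i < n then Sum.inl (Sum.inl i) else if i = n then Sum.inl (Sum.inr 0)
    else if h : i < N then Sum.inr ⟨i, h⟩ else Sum.inl (Sum.inr 0)
  let θ : L.Formula ((ℕ ⊕ Fin 1) ⊕ Fin N) := Formula.iInf fun φ : Φ => φ.1.relabel g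
  refine ⟨θ.iExs (Fin N), fun v x => ?_⟩
  rw [Formula.realize_iExs]
  simp only [θ, Formula.realize_iInf, Formula.realize_relabel, Subtype.forall]
  constructor
  · rintro ⟨z, hz⟩
    refine ⟨Sum.elim (Sum.elim v fun _ => x) z ∘ g, ?_, ?_, hz⟩
    · intro i hi
      simp [g, hi]
    · simp [g]
  · rintro ⟨w, hw, rfl, hΦ⟩
    refine ⟨fun i => w i, fun φ hφ => (realize_congr φ ?_).1 (hΦ φ hφ)⟩
    intro i hi
    have := hN φ hφ i hi
    simp only [g, Function.comp]
    split_ifs with h1 h2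
    · simp [hw i h1]
    · simp [h2]
    · simp

theorem sat_omega {L : FirstOrder.Language.{0, 0}} {U : Type} [L.Structure U] [Nonempty U]
    (hsat : AlephOneSaturated L U) {T : Type} (G : T → L.Formula ℕ)
    (hfin : ∀ s : Finset T, ∃ v : ℕ → U, ∀ t ∈ s, (G t).Realize v) :
    ∃ v : ℕ → U, ∀ t, (G t).Realize v := by
  classical
  let Good : ℕ → (ℕ → U) → Prop := fun n v =>
    ∀ s : Finset T, ∃ w : ℕ → U, (∀ i < n, w i = v i) ∧ ∀ t ∈ s, (G t).Realize w
  have step : ∀ n v, Good n v → ∃ x, Good (n + 1) (Function.update v n x) := by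
    intro n v hv
    choose E hE using fun s : Finset T => exists_ex_formula (U := U) (s.image G) n
    obtain ⟨x, hx⟩ := hsat v (Set.range E) (by
      intro Φ₀ hΦ
      obtain ⟨S, hS⟩ : ∃ S : Finset (Finset T), Φ₀ = S.image E := by
        rw [← Set.image_univ] at hΦ
        obtain ⟨S, -, hS⟩ := Finset.subset_set_image_iff.1 hΦ
        exact ⟨S, hS.symm⟩
      obtain ⟨w, hw1, hw2⟩ := hv (S.biUnion id)
      refine ⟨w n, fun φ hφ => ?_⟩
      rw [hS, Finset.mem_image] at hφ
      obtain ⟨s, hs, rfl⟩ := hφ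
      rw [hE]
      refine ⟨w, hw1, rfl, ?_⟩
      intro φ hφ
      obtain ⟨t, ht, rfl⟩ := Finset.mem_image.1 hφ
      exact hw2 t (Finset.mem_biUnion.2 ⟨s, hs, ht⟩))
    refine ⟨x, fun s => ?_⟩
    obtain ⟨w, hw, hwn, hG⟩ := (hE s v x).1 (hx _ ⟨s, rfl⟩)
    refine ⟨w, fun i hi => ?_, fun t ht => hG _ (Finset.mem_image_of_mem _ ht)⟩
    rcases Nat.lt_succ_iff_lt_or_eq.1 hi with h | rfl
    · rw [Function.update_of_ne h.ne, hw i h]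
    · rw [Function.update_self, hwn]
  choose! x hx using step
  let V : ℕ → ℕ → U := fun n => Nat.rec (fun _ => Classical.arbitrary U)
    (fun n v => Function.update v n (x n v)) n
  have hV : ∀ n, Good n (V n) := by
    intro n
    induction n with
    | zero =>
      intro s
      obtain ⟨v, hv⟩ := hfin s
      exact ⟨v, fun i hi => absurd hi (Nat.not_lt_zero i), hv⟩
    | succ n ih => exact hx n _ ih
  have hstab : ∀ i n, i < n → V n i = V (i + 1) i := by
    intro i n hin
    induction n with
    | zero => omega
    | succ n ih =>
      rcases Nat.lt_succ_iff_lt_or_eq.1 hin with h | rfl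
      · rw [← ih h]
        exact Function.update_of_ne h.ne _ _
      · rfl
  refine ⟨fun i => V (i + 1) i, fun t => ?_⟩
  obtain ⟨w, hw, hG⟩ := hV ((G t).freeVarFinset.sup id + 1) {t}
  refine (realize_congr (G t) ?_).1 (hG t (Finset.mem_singleton_self t))
  intro i hi
  have : i ≤ (G t).freeVarFinset.sup id := Finset.le_sup (f := id) hi
  rw [hw i (by omega)]
  exact hstab i _ (Nat.lt_succ_of_le this)

end SRPaper
namespace SRPaper

section dir1

variable {L' : Language} {I : Type} [L'.Structure I]

theorem finite_of_age (hlocfin : ∀ S : L'.Substructure I, S.FG → (S : Set I).Finite)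
    {A : Bundled L'.Structure} (hA : A ∈ L'.age I) : Finite A := by
  obtain ⟨hfg, ⟨f⟩⟩ := hA
  have h1 := hlocfin _ (hfg.range f.toHom)
  have : Finite f.toHom.range := h1
  exact Finite.of_equiv _ f.equivRange.toEquiv.symm

theorem rigid [LinearOrder I]
    (hlocfin : ∀ S : L'.Substructure I, S.FG → (S : Set I).Finite)
    (ltSymb : L'.Relations 2)
    (hlt : ∀ a b : I, Structure.RelMap ltSymb ![a, b] ↔ a < b)
    {A C : Bundled L'.Structure} (hA : A ∈ L'.age I) (hC : C ∈ L'.age I)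
    (e e' : A ↪[L'] C) (h : Set.range e = Set.range e') : e = e' := by
  have hfin := finite_of_age hlocfin hA
  obtain ⟨-, ⟨g⟩⟩ := hA
  obtain ⟨-, ⟨f⟩⟩ := hC
  let _ : LinearOrder A := LinearOrder.lift' g g.injective
  have hmono : ∀ u : A ↪[L'] I, StrictMono u := by
    intro u x y hxy
    have h1 : g x < g y := hxy
    rw [← hlt] at h1 ⊢
    have e1 : ![g x, g y] = g ∘ ![x, y] := by ext i; fin_cases i <;> rfl
    have e2 : ![u x, u y] = u ∘ ![x, y] := by ext i; fin_cases i <;> rfl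
    rw [e1, Embedding.map_rel] at h1
    rwa [e2, Embedding.map_rel]
  have hr : Set.range (f.comp e) = Set.range (f.comp e') := by
    have h1 : ∀ u : A ↪[L'] C, Set.range (f.comp u) = Set.image f (Set.range u) := by
      intro u
      ext y
      simp
    rw [h1, h1, h]
  have := (StrictMono.range_inj (hmono (f.comp e)) (hmono (f.comp e'))).1 hr
  ext x
  exact f.injective (congrFun this x)

theorem ramsey_emb [LinearOrder I]
    (hlocfin : ∀ S : L'.Substructure I, S.FG → (S : Set I).Finite)
    (ltSymb : L'.Relations 2)
    (hlt : ∀ a b : I, Structure.RelMap ltSymb ![a, b] ↔ a < b)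
    (hR : RamseyClass L' (L'.age I))
    {A B : Bundled L'.Structure} (hA : A ∈ L'.age I) (hB : B ∈ L'.age I) :
    ∃ C ∈ L'.age I, ∀ c : (A ↪[L'] C) → Prop, ∃ h : B ↪[L'] C,
      ∀ e e' : A ↪[L'] B, c (h.comp e) ↔ c (h.comp e') := by
  classical
  obtain ⟨C, hC, hh⟩ := hR A B hA hB 2 (by norm_num)
  refine ⟨C, hC, fun c => ?_⟩
  obtain ⟨B', ⟨β⟩, hB'⟩ := hh (fun D =>
    if ∃ e : A ↪[L'] C, Set.range e = (D : Set C) ∧ c e then 1 else 0)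
  let h : B ↪[L'] C := B'.subtype.comp β.toEmbedding
  have hle : ∀ e : A ↪[L'] B, (h.comp e).toHom.range ≤ B' := by
    rintro e _ ⟨x, rfl⟩
    exact (β (e x)).2
  have hcol : ∀ e : A ↪[L'] C,
      (∃ e' : A ↪[L'] C, Set.range e' = (e.toHom.range : Set C) ∧ c e') ↔ c e := by
    intro e
    constructor
    · rintro ⟨e', he', hc⟩
      rw [Hom.range_coe] at he'
      rwa [← rigid hlocfin ltSymb hlt hA hC e' e he']
    · intro hc
      exact ⟨e, (Hom.range_coe e.toHom).symm, hc⟩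
  refine ⟨h, fun e e' => ?_⟩
  have := hB' _ _ (hle e) (hle e') ⟨(h.comp e).equivRange⟩ ⟨(h.comp e').equivRange⟩
  simp only [hcol] at this
  by_cases h1 : c (h.comp e) <;> by_cases h2 : c (h.comp e') <;> simp_all

theorem ramsey_multi [LinearOrder I]
    (hlocfin : ∀ S : L'.Substructure I, S.FG → (S : Set I).Finite)
    (ltSymb : L'.Relations 2)
    (hlt : ∀ a b : I, Structure.RelMap ltSymb ![a, b] ↔ a < b)
    (hR : RamseyClass L' (L'.age I))
    {T : Type*} (A : T → Bundled L'.Structure) (hA : ∀ t, A t ∈ L'.age I) (s : Finset T) :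
    ∀ B : Bundled L'.Structure, B ∈ L'.age I → 
    ∃ C ∈ L'.age I, ∀ c : ∀ t, (A t ↪[L'] C) → Prop, ∃ h : B ↪[L'] C,
      ∀ t ∈ s, ∀ e e' : A t ↪[L'] B, c t (h.comp e) ↔ c t (h.comp e') := by
  classical
  induction s using Finset.induction_on with
  | empty => exact fun B hB => ⟨B, hB, fun c => ⟨Embedding.refl _ _, by simp⟩⟩
  | insert t s ht ih =>
    intro B hB
    obtain ⟨C, hC, h1⟩ := ih B hB
    obtain ⟨D, hD, h2⟩ := ramsey_emb hlocfin ltSymb hlt hR (hA t) hC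
    refine ⟨D, hD, fun c => ?_⟩
    obtain ⟨g, hg⟩ := h2 (c t)
    obtain ⟨h, hh⟩ := h1 (fun t e => c t (g.comp e))
    refine ⟨g.comp h, fun u hu e e' => ?_⟩
    rcases Finset.mem_insert.1 hu with rfl | hu
    · exact hg (h.comp e) (h.comp e')
    · exact hh u hu e e'

/-- Data of an indiscernibility requirement. -/
structure IndData (L' : Language) (I : Type) [L'.Structure I] (L : FirstOrder.Language.{0, 0})
    (d : ℕ) where
  n : ℕ
  ι : Fin n → I
  κ : Fin n → I
  same : SameQfTp L' I ι κ
  φ : L.Formula (Fin n × Fin d)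

/-- Data of an EM-type requirement. -/
structure EMData (L' : Language) (I : Type) [L'.Structure I] (L : FirstOrder.Language.{0, 0})
    (U : Type) [L.Structure U] (d : ℕ) (X : I → Fin d → U) where
  n : ℕ
  ι : Fin n → I
  φ : L.Formula (Fin n × Fin d)
  holds : ∀ κ : Fin n → I, SameQfTp L' I ι κ → φ.Realize fun p => X (κ p.1) p.2

/-- A substructure as a bundled structure. -/
abbrev bun (S : L'.Substructure I) : Bundled L'.Structure := ⟨S, inferInstance⟩

theorem closure_mem_age {s : Set I} (hs : s.Finite) :
    bun (Substructure.closure L' s) ∈ L'.age I :=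
  ⟨(Substructure.fg_iff_structure_fg _).1 (Substructure.fg_closure hs),
    ⟨Substructure.subtype _⟩⟩

theorem modeling_of_ramsey [Countable I] [LinearOrder I]
    (hlocfin : ∀ S : L'.Substructure I, S.FG → (S : Set I).Finite)
    (ltSymb : L'.Relations 2)
    (hlt : ∀ a b : I, Structure.RelMap ltSymb ![a, b] ↔ a < b)
    (hR : RamseyClass L' (L'.age I)) : ModelingProperty L' I := by
  classical
  intro L U _ hsat d X
  rcases isEmpty_or_nonempty U with hU | hU
  · refine ⟨X, ?_, ?_⟩
    · intro n ι κ _ φ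
      have : (fun p : Fin n × Fin d => X (ι p.1) p.2) = fun p => X (κ p.1) p.2 :=
        funext fun p => isEmptyElim (X (ι p.1) p.2)
      rw [this]
    · intro n φ ι h
      exact h ι (fun _ _ => Iff.rfl)
  obtain ⟨f, hf⟩ := exists_injective_nat (I × Fin d)
  let G : IndData L' I L d ⊕ EMData L' I L U d X → L.Formula ℕ := Sum.elim
    (fun t => (t.φ.relabel fun p => f (t.ι p.1, p.2)).iff (t.φ.relabel fun p => f (t.κ p.1, p.2)))
    (fun t => t.φ.relabel fun p => f (t.ι p.1, p.2))
  obtain ⟨v, hv⟩ := sat_omega hsat G (by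
    intro s
    let A : IndData L' I L d → Bundled L'.Structure :=
      fun t => bun (Substructure.closure L' (Set.range t.ι))
    have hA : ∀ t, A t ∈ L'.age I := fun t => closure_mem_age (Set.finite_range _)
    -- the finite set of indices involved
    let S : Set I := ⋃ t ∈ s, Sum.elim
      (fun t : IndData L' I L d => Set.range t.ι ∪ Set.range t.κ)
      (fun t : EMData L' I L U d X => Set.range t.ι) t
    have hS : S.Finite := by
      refine s.finite_toSet.biUnion fun t _ => ?_
      rcases t with t | t
      · exact (Set.finite_range _).union (Set.finite_range _)
      · exact Set.finite_range _
    let B := Substructure.closure L' S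
    obtain ⟨C, hC, hh⟩ := ramsey_multi hlocfin ltSymb hlt hR A hA s.toLeft (bun B)
      (closure_mem_age hS)
    obtain ⟨-, ⟨g⟩⟩ := hC
    obtain ⟨h, hh⟩ := hh (fun t e => t.φ.Realize fun p =>
      X (g (e ⟨t.ι p.1, Substructure.subset_closure ⟨p.1, rfl⟩⟩)) p.2)
    let H : B ↪[L'] I := g.comp h
    let H' : I → I := fun i => if hi : i ∈ B then H ⟨i, hi⟩ else i
    let v : ℕ → U := fun m => if hm : ∃ q, f q = m then X (H' hm.choose.1) hm.choose.2
      else Classical.arbitrary U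
    have hvf : ∀ i l, v (f (i, l)) = X (H' i) l := by
      intro i l
      have hm : ∃ q, f q = f (i, l) := ⟨_, rfl⟩
      have : hm.choose = (i, l) := hf hm.choose_spec
      simp only [v, dif_pos hm, this]
    have hH' : ∀ i (hi : i ∈ B), H' i = H ⟨i, hi⟩ := fun i hi => dif_pos hi
    refine ⟨v, ?_⟩
    rintro (t | t) ht
    · have hι : ∀ j, t.ι j ∈ B := fun j => Substructure.subset_closure
        (Set.mem_biUnion ht (Or.inl ⟨j, rfl⟩))
      have hκ : ∀ j, t.κ j ∈ B := fun j => Substructure.subset_closure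
        (Set.mem_biUnion ht (Or.inr ⟨j, rfl⟩))
      obtain ⟨e, he⟩ := exists_emb_of_same t.same
      have heB : ∀ x, e x ∈ B := by
        have : Substructure.closure L' (Set.range t.ι) ≤
            (B.comap e.toHom).map (Substructure.subtype _).toHom := by
          rw [Substructure.closure_le]
          rintro _ ⟨j, rfl⟩
          refine ⟨⟨t.ι j, Substructure.subset_closure ⟨j, rfl⟩⟩, ?_, rfl⟩
          change e _ ∈ B
          rw [he]
          exact hκ j
        intro x
        obtain ⟨y, hy, hyx⟩ := this x.2
        have : y = x := Subtype.ext hyx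
        rw [← this]
        exact hy
      let e1 : A t ↪[L'] B := Substructure.inclusion (by
        rw [Substructure.closure_le]
        rintro _ ⟨j, rfl⟩
        exact hι j)
      let e2 : A t ↪[L'] B := e.codRestrict B heB
      have key := hh t (Finset.mem_toLeft.2 ht) e1 e2
      simp only [G, Sum.elim_inl, Formula.realize_iff, Formula.realize_relabel,
        Function.comp_def, hvf]
      convert! key using 3 with p p
      · rw [hH' _ (hι _)]
        rfl
      · rw [hH' _ (hκ _)]
        change X (g (h _)) _ = X (g (h _)) _
        congr 3
        exact Subtype.ext (he p.1).symm
    · have hι : ∀ j, t.ι j ∈ B := fun j => Substructure.subset_closure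
        (Set.mem_biUnion ht ⟨j, rfl⟩)
      simp only [G, Sum.elim_inr, Formula.realize_relabel, Function.comp_def, hvf]
      refine t.holds (fun j => H' (t.ι j)) ?_
      have := same_of_emb (B.subtype) H (fun j => ⟨t.ι j, hι j⟩)
      convert! this using 1
      funext j
      exact hH' _ (hι j))
  refine ⟨fun i l => v (f (i, l)), ?_, ?_⟩
  · intro n ι κ hs φ
    have := hv (Sum.inl ⟨n, ι, κ, hs, φ⟩)
    simpa [G, Function.comp_def] using this
  · intro n φ ι hφ
    have := hv (Sum.inr ⟨n, ι, φ, hφ⟩)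
    simpa [G, Function.comp_def] using this

end dir1

end SRPaper
namespace SRPaper

section dir2

theorem ultrapower_sat (L : FirstOrder.Language.{0, 0}) [Countable L.Symbols] (M : Type)
    [L.Structure M] [Nonempty M] :
    AlephOneSaturated L ((Filter.hyperfilter ℕ : Filter ℕ).Product fun _ => M) := by
  classical
  intro p Φ hΦ
  rcases Φ.eq_empty_or_nonempty with rfl | hne
  · exact ⟨p 0, by simp⟩
  obtain ⟨φ, hφ⟩ := (Set.to_countable Φ).exists_eq_range hne
  have hp : ∃ p' : ℕ → ℕ → M,
      p = fun j => (p' j : (Filter.hyperfilter ℕ : Filter ℕ).Product fun _ => M) :=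
    ⟨fun j => (p j).out, funext fun j => (Quotient.out_eq (p j)).symm⟩
  obtain ⟨p', rfl⟩ := hp
  let P : ℕ → ℕ → Prop := fun n m =>
    ∃ x : M, ∀ i < m, (φ i).Realize (Sum.elim (fun j => p' j n) fun _ => x)
  have hP0 : ∀ n, P n 0 := fun n => ⟨Classical.arbitrary M, fun i hi => absurd hi (Nat.not_lt_zero i)⟩
  have hspec : ∀ n, P n (Nat.findGreatest (P n) n) := fun n =>
    Nat.findGreatest_spec (Nat.zero_le n) (hP0 n)
  choose x hx using hspec
  have cast_elim : ∀ y : ℕ → M,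
      (Sum.elim (fun j => (p' j : (Filter.hyperfilter ℕ : Filter ℕ).Product fun _ => M))
        fun _ => (y : (Filter.hyperfilter ℕ : Filter ℕ).Product fun _ => M) :
        ℕ ⊕ Fin 1 → _) =
      fun i => ((Sum.elim p' (fun _ => y) : ℕ ⊕ Fin 1 → ℕ → M) i :
        (Filter.hyperfilter ℕ : Filter ℕ).Product fun _ => M) := by
    intro y
    funext i
    rcases i with i | i <;> rfl
  have elim_app : ∀ (y : ℕ → M) (n : ℕ),
      (fun i => (Sum.elim p' (fun _ => y) : ℕ ⊕ Fin 1 → ℕ → M) i n) =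
      Sum.elim (fun j => p' j n) fun _ => y n := by
    intro y n
    funext i
    rcases i with i | i <;> rfl
  have hlos : ∀ (ψ : L.Formula (ℕ ⊕ Fin 1)) (y : ℕ → M),
      ψ.Realize (Sum.elim (fun j => (p' j : (Filter.hyperfilter ℕ : Filter ℕ).Product fun _ => M))
        fun _ => (y : (Filter.hyperfilter ℕ : Filter ℕ).Product fun _ => M)) ↔
      ∀ᶠ n in (Filter.hyperfilter ℕ : Filter ℕ),
        ψ.Realize (Sum.elim (fun j => p' j n) fun _ => y n) := by
    intro ψ y
    have h := Ultraproduct.realize_formula_cast (u := Filter.hyperfilter ℕ) (M := fun _ => M) ψ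
      (Sum.elim p' (fun _ => y))
    simp only [elim_app] at h
    exact (iff_of_eq (congrArg _ (cast_elim y))).trans h
  refine ⟨(x : (Filter.hyperfilter ℕ : Filter ℕ).Product fun _ => M), ?_⟩
  rw [hφ]
  rintro _ ⟨i, rfl⟩
  refine (hlos _ x).2 ?_
  have h1 : ∀ᶠ n in (Filter.hyperfilter ℕ : Filter ℕ), P n (i + 1) := by
    obtain ⟨y, hy⟩ := hΦ ((Finset.range (i + 1)).image φ) (by
      rw [hφ]
      intro ψ hψ
      obtain ⟨j, -, rfl⟩ := Finset.mem_image.1 (Finset.mem_coe.1 hψ)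
      exact ⟨j, rfl⟩)
    obtain ⟨y', rfl⟩ : ∃ y' : ℕ → M,
        (y' : (Filter.hyperfilter ℕ : Filter ℕ).Product fun _ => M) = y :=
      ⟨y.out, Quotient.out_eq y⟩
    have h2 : ∀ j ∈ Finset.range (i + 1), ∀ᶠ n in (Filter.hyperfilter ℕ : Filter ℕ),
        (φ j).Realize (Sum.elim (fun l => p' l n) fun _ => y' n) := by
      intro j hj
      exact (hlos _ y').1 (hy (φ j) (Finset.mem_image_of_mem _ hj))
    rw [← Filter.eventually_all_finset] at h2
    filter_upwards [h2] with n hn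
    exact ⟨y' n, fun j hj => hn j (Finset.mem_range.2 hj)⟩
  have h3 : ∀ᶠ n in (Filter.hyperfilter ℕ : Filter ℕ), i + 1 ≤ n :=
    Nat.hyperfilter_le_atTop (Filter.eventually_ge_atTop (i + 1))
  filter_upwards [h1, h3] with n hn1 hn2
  exact hx n i (Nat.lt_of_succ_le (Nat.le_findGreatest hn2 hn1))

/-- The language with `k` relation symbols of each arity. -/
def colorLang (k : ℕ) : FirstOrder.Language.{0, 0} := ⟨fun _ => Empty, fun _ => Fin k⟩

instance (k : ℕ) : Countable (colorLang k).Symbols := by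
  unfold Language.Symbols colorLang
  infer_instance

variable {L' : Language} {I : Type} [L'.Structure I]

def colorStr {k : ℕ} (c : L'.Substructure I → Fin k) : (colorLang k).Structure I where
  funMap := fun f => Empty.elim f
  RelMap := fun r t => c (Substructure.closure L' (Set.range t)) = r

theorem homog_of_modeling [Nonempty I]
    (hlocfin : ∀ S : L'.Substructure I, S.FG → (S : Set I).Finite)
    (hM : ModelingProperty L' I) {A B : Bundled L'.Structure}
    (hA : A ∈ L'.age I) (hB : B ∈ L'.age I) {k : ℕ} (c : L'.Substructure I → Fin k) :
    ∃ B' : L'.Substructure I, Nonempty (B ≃[L'] B') ∧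
      ∀ A₁ A₂ : L'.Substructure I, A₁ ≤ B' → A₂ ≤ B' →
        Nonempty (A ≃[L'] A₁) → Nonempty (A ≃[L'] A₂) → c A₁ = c A₂ := by
  classical
  have hAf := finite_of_age hlocfin hA
  have hBf := finite_of_age hlocfin hB
  obtain ⟨-, ⟨g⟩⟩ := hB
  by_cases hemb : Nonempty (A ↪[L'] B)
  swap
  · refine ⟨g.toHom.range, ⟨g.equivRange⟩, fun A₁ A₂ h1 h2 ⟨f1⟩ _ => (hemb ⟨?_⟩).elim⟩
    exact g.equivRange.symm.toEmbedding.comp ((Substructure.inclusion h1).comp f1.toEmbedding)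
  obtain ⟨e₀⟩ := hemb
  letI := colorStr c
  let L := colorLang k
  let U := (Filter.hyperfilter ℕ : Filter ℕ).Product fun _ => I
  let X : I → Fin 1 → U := fun i _ => ((fun _ => i : ℕ → I) : U)
  obtain ⟨Y, hY, hXY⟩ := hM L U (ultrapower_sat L I) 1 X
  obtain ⟨n, ⟨a⟩⟩ := Finite.exists_equiv_fin A
  obtain ⟨m, ⟨b⟩⟩ := Finite.exists_equiv_fin B
  -- formulas on X
  have hX : ∀ {q : ℕ} (φ : L.Formula (Fin q × Fin 1)) (κ : Fin q → I),
      (φ.Realize fun p => X (κ p.1) p.2) ↔ φ.Realize (fun p => κ p.1) := by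
    intro q φ κ
    have := Ultraproduct.realize_formula_cast (u := Filter.hyperfilter ℕ) (M := fun _ => I) φ
      (fun p _ => κ p.1)
    rw [Filter.eventually_const] at this
    exact this
  -- the color formulas
  let R : ∀ {q : ℕ}, (Fin n → Fin q) → Fin k → L.Formula (Fin q × Fin 1) := fun s i =>
    Relations.formula (L := L) (n := n) i (fun j => Term.var (s j, 0))
  have hR : ∀ {q : ℕ} (s : Fin n → Fin q) (i : Fin k) (κ : Fin q → I),
      (R s i).Realize (fun p => κ p.1) ↔
        c (Substructure.closure L' (Set.range (κ ∘ s))) = i := by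
    intro q s i κ
    simp only [R, Formula.realize_rel]
    exact Iff.rfl
  let ιb : Fin m → I := fun j => g (b.symm j)
  let σ : (A ↪[L'] B) → Fin n → Fin m := fun e j => b (e (a.symm j))
  have hσ : ∀ e, ιb ∘ σ e = (g.comp e) ∘ a.symm := by
    intro e
    funext j
    simp [ιb, σ]
  -- color of Y
  obtain ⟨i, hi⟩ : ∃ i, (R (σ e₀) i).Realize (fun p => Y (ιb p.1) p.2) := by
    have := hXY m (Formula.iSup fun i : Fin k => R (σ e₀) i) ιb (by
      intro κ _
      rw [hX, Formula.realize_iSup]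
      exact ⟨_, (hR _ _ _).2 rfl⟩)
    rwa [Formula.realize_iSup] at this
  have hall : ∀ e, (R (σ e) i).Realize (fun p => Y (ιb p.1) p.2) := by
    intro e
    have hrel : ∀ e : A ↪[L'] B, (R (σ e) i).Realize (fun p => Y (ιb p.1) p.2) ↔
        (R id i).Realize (fun p => Y (((g.comp e) ∘ a.symm) p.1) p.2) := by
      intro e
      rw [← hσ]
      simp only [R, Formula.realize_rel]
      exact Iff.rfl
    rw [hrel] at hi ⊢
    exact (hY n _ _ (same_of_emb (g.comp e₀) (g.comp e) a.symm) _).1 hi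
  have hfinE : Finite (A ↪[L'] B) := DFunLike.finite _
  -- transfer to X
  obtain ⟨κ, hκ, hκc⟩ : ∃ κ : Fin m → I, SameQfTp L' I ιb κ ∧
      ∀ e, c (Substructure.closure L' (Set.range (κ ∘ σ e))) = i := by
    by_contra hcon
    push Not at hcon
    have := hXY m (Formula.iInf fun e : A ↪[L'] B => R (σ e) i).not ιb (by
      intro κ hκ
      rw [hX, Formula.realize_not, Formula.realize_iInf]
      intro h
      obtain ⟨e, he⟩ := hcon κ hκ
      exact he ((hR _ _ _).1 (h e)))
    rw [Formula.realize_not, Formula.realize_iInf] at this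
    exact this hall
  obtain ⟨h, hh⟩ := exists_emb_of_same hκ
  have hgm : ∀ x : B, g x ∈ Substructure.closure L' (Set.range ιb) := fun x =>
    Substructure.subset_closure ⟨b x, by simp [ιb]⟩
  let H : B ↪[L'] I := h.comp (g.codRestrict _ hgm)
  have hH : ∀ x, H x = κ (b x) := by
    intro x
    rw [← hh]
    change h _ = h _
    congr 1
    exact Subtype.ext (by simp [ιb])
  refine ⟨H.toHom.range, ⟨H.equivRange⟩, ?_⟩
  have hone : ∀ A₁ : L'.Substructure I, A₁ ≤ H.toHom.range → Nonempty (A ≃[L'] A₁) → c A₁ = i := by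
    rintro A₁ hle ⟨f⟩
    let e : A ↪[L'] B := H.equivRange.symm.toEmbedding.comp
      ((Substructure.inclusion hle).comp f.toEmbedding)
    have he : ∀ x, H (e x) = f x := by
      intro x
      rw [← Embedding.equivRange_apply]
      change ((H.equivRange (H.equivRange.symm _) : H.toHom.range) : I) = _
      exact congrArg Subtype.val (FirstOrder.Language.Equiv.apply_symm_apply H.equivRange _)
    rw [← hκc e]
    congr 1
    have : Set.range (κ ∘ σ e) = (A₁ : Set I) := by
      ext y
      constructor
      · rintro ⟨j, rfl⟩
        simp only [Function.comp, σ, ← hH, he]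
        exact (f _).2
      · intro hy
        refine ⟨a (f.symm ⟨y, hy⟩), ?_⟩
        simp only [Function.comp, σ, ← hH, he]
        simp
    rw [this, Substructure.closure_eq]
  intro A₁ A₂ h1 h2 h3 h4
  rw [hone A₁ h1 h3, hone A₂ h2 h4]

theorem ramsey_of_homog
    (hlocfin : ∀ S : L'.Substructure I, S.FG → (S : Set I).Finite)
    {A B : Bundled L'.Structure} (hB : B ∈ L'.age I) {k : ℕ} 
    (hom : ∀ c : L'.Substructure I → Fin k,
      ∃ B' : L'.Substructure I, Nonempty (B ≃[L'] B') ∧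
        ∀ A₁ A₂ : L'.Substructure I, A₁ ≤ B' → A₂ ≤ B' →
          Nonempty (A ≃[L'] A₁) → Nonempty (A ≃[L'] A₂) → c A₁ = c A₂) :
    ∃ C : Bundled L'.Structure, C ∈ L'.age I ∧
      ∀ c : L'.Substructure C → Fin k,
        ∃ B' : L'.Substructure C, Nonempty (B ≃[L'] B') ∧
          ∀ A₁ A₂ : L'.Substructure C, A₁ ≤ B' → A₂ ≤ B' →
            Nonempty (A ≃[L'] A₁) → Nonempty (A ≃[L'] A₂) → c A₁ = c A₂ := by
  classical
  by_contra hcon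
  push Not at hcon
  have hbad := fun s : Finset I => hcon (bun (Substructure.closure L' (s : Set I)))
    (closure_mem_age s.finite_toSet)
  choose c hc using hbad
  let F : Ultrafilter (Finset I) := Ultrafilter.of Filter.atTop
  have hF : (F : Filter (Finset I)) ≤ Filter.atTop := Ultrafilter.of_le _
  have hlim : ∀ D : L'.Substructure I, ∃ i : Fin k, ∀ᶠ s in (F : Filter (Finset I)),
      c s (D.comap (Substructure.subtype _).toHom) = i := by
    intro D
    obtain ⟨i, hi⟩ := Ultrafilter.eq_pure_of_finite
      (F.map fun s => c s (D.comap (Substructure.subtype _).toHom))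
    refine ⟨i, ?_⟩
    have : ({i} : Set (Fin k)) ∈ F.map fun s => c s (D.comap (Substructure.subtype _).toHom) := by
      rw [hi]
      exact Set.mem_singleton i
    exact this
  choose cc hcc using hlim
  obtain ⟨B', ⟨β⟩, hB'⟩ := hom cc
  have hBf := finite_of_age hlocfin hB
  have hB'f : (B' : Set I).Finite := by
    have : Finite B' := Finite.of_equiv _ β.toEquiv
    exact this
  have hsub : {D : L'.Substructure I | D ≤ B'}.Finite := by
    refine Set.Finite.of_finite_image (f := fun D : L'.Substructure I => (D : Set I)) ?_
      (SetLike.coe_injective.injOn)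
    refine hB'f.finite_subsets.subset ?_
    rintro _ ⟨D, hD, rfl⟩
    exact hD
  have h1 := (Filter.eventually_all_finite hsub).2 (fun D _ => hcc D)
  have h2 : ∀ᶠ s in (F : Filter (Finset I)), hB'f.toFinset ≤ s :=
    hF (Filter.eventually_ge_atTop _)
  obtain ⟨s, hs1, hs2⟩ := (h1.and h2).exists
  let S := Substructure.closure L' (s : Set I)
  have hBS : B' ≤ S := fun x hx =>
    Substructure.subset_closure (hs2 (hB'f.mem_toFinset.2 hx))
  let B₂ : L'.Substructure S := (Substructure.inclusion hBS).toHom.range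
  have hB₂ : ∀ y : S, y ∈ B₂ → (y : I) ∈ B' := by
    rintro _ ⟨x, rfl⟩
    exact x.2
  obtain ⟨A₁, A₂, hA₁, hA₂, ⟨f₁⟩, ⟨f₂⟩, hne⟩ := hc s B₂
    ⟨(Substructure.inclusion hBS).equivRange.comp β⟩
  have key : ∀ D : L'.Substructure S, D ≤ B₂ → c s D = cc (D.map S.subtype.toHom) := by
    intro D hD
    rw [← hs1 (D.map S.subtype.toHom) (by
      rintro _ ⟨x, hx, rfl⟩
      exact hB₂ x (hD hx))]
    congr 1
    exact (Substructure.comap_map_eq_of_injective S.subtype.injective D).symm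
  have hle : ∀ D : L'.Substructure S, D ≤ B₂ → D.map S.subtype.toHom ≤ B' := by
    rintro D hD _ ⟨x, hx, rfl⟩
    exact hB₂ x (hD hx)
  apply hne
  rw [key A₁ hA₁, key A₂ hA₂]
  exact hB' _ _ (hle _ hA₁) (hle _ hA₂) ⟨(S.subtype.substructureEquivMap A₁).comp f₁⟩
    ⟨(S.subtype.substructureEquivMap A₂).comp f₂⟩

theorem ramsey_of_modeling
    (hlocfin : ∀ S : L'.Substructure I, S.FG → (S : Set I).Finite)
    (hM : ModelingProperty L' I) : RamseyClass L' (L'.age I) := by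
  intro A B hA hB k _
  rcases isEmpty_or_nonempty I with hI | hI
  · obtain ⟨-, ⟨g⟩⟩ := id hB
    refine ⟨B, hB, fun c => ⟨⊤, ⟨Substructure.topEquiv.symm⟩, ?_⟩⟩
    intro A₁ A₂ _ _ _ _
    congr 1
    ext x
    exact isEmptyElim (g x)
  · exact ramsey_of_homog hlocfin hB (fun c => homog_of_modeling hlocfin hM hA hB c)

end dir2

end SRPaper

open SRPaper in
/-- For a countable, locally finite structure `I` in a language `L'` with a
binary relation linearly ordering `I`, `I`-indexed indiscernible sets have the modeling
property iff `age(I)` has the Ramsey property (no `qfi` assumption needed). -/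
theorem statement0 (L' : Language) (I : Type) [L'.Structure I] [Countable I] [LinearOrder I]
    (hlocfin : ∀ S : L'.Substructure I, S.FG → (S : Set I).Finite)
    (ltSymb : L'.Relations 2)
    (hlt : ∀ a b : I, Structure.RelMap ltSymb ![a, b] ↔ a < b) :
    ModelingProperty L' I ↔ RamseyClass L' (L'.age I) := by
  exact ⟨ramsey_of_modeling hlocfin, modeling_of_ramsey hlocfin ltSymb hlt⟩
end

section
/- Let I-script be a countable relational L2-structure linearly ordered by <, with underlying order I, and for each i in I let M_i be a countable relational L1-structure linearly ordered by <, where L1 ∩ L2 = {<} and all M_i have the same age K. If age(I-script) has the Ramsey property and K has the Ramsey property, then the age of the semi-direct product structure I-script_{i in I}(M_i) has the Ramsey property. -/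
open FirstOrder FirstOrder.Language FirstOrder.Language.Structure CategoryTheory

namespace SRPaper

/-! ### Disjoint unions and semi-direct product structures

An "ordered `L`-structure" is modelled as a type with an `L.Structure` instance (for the
relations other than `<`) together with a `LinearOrder` instance (interpreting `<`); its full
language is `L.sum Language.order`. -/

attribute [local instance] FirstOrder.Language.orderStructure

/-- Relation symbols `E`: a single binary symbol. -/
inductive EqSymb : ℕ → Type
  | E : EqSymb 2

/-- The language `{E}` with one binary relation. -/
def langE : Language := ⟨fun _ => Empty, EqSymb⟩

/-- Unary predicate symbols `P i` for `i : O`. -/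
inductive PredSymb (O : Type) : ℕ → Type
  | P (i : O) : PredSymb O 1

/-- The language `{P_i : i ∈ O}` of unary predicates. -/
def langP (O : Type) : Language := ⟨fun _ => Empty, PredSymb O⟩

/-- A single binary relation symbol (for graphs). -/
inductive GrSymb : ℕ → Type
  | adj : GrSymb 2

/-- The language of graphs: one binary relation. -/
def langGr : Language := ⟨fun _ => Empty, GrSymb⟩

instance : langGr.IsRelational := fun _ => inferInstanceAs (IsEmpty Empty)

section Constructions

variable (O : Type) [LinearOrder O]

/-- Interpretation of a relational language `L1` on the disjoint union `Σₗ i, M i`,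
where each relation is computed fiberwise (and fails on tuples meeting several fibers). -/
def fiberStructure (L1 : Language) [L1.IsRelational] (M : O → Type)
    [∀ i, L1.Structure (M i)] : L1.Structure (Σₗ i, M i) where
  funMap := fun f _ => isEmptyElim f
  RelMap := fun {n} r v =>
    ∃ (i : O) (w : Fin n → M i), (∀ k, v k = toLex ⟨i, w k⟩) ∧ Structure.RelMap r w

/-- Interpretation of a relational language `L2` on the disjoint union `Σₗ i, M i` via the
projection to the index structure `O`. -/
def projStructure (L2 : Language) [L2.IsRelational] [L2.Structure O] (M : O → Type) :
    L2.Structure (Σₗ i, M i) where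
  funMap := fun f _ => isEmptyElim f
  RelMap := fun {n} r v => Structure.RelMap r fun k => (ofLex (v k)).1

/-- Interpretation of `E` on `Σₗ i, M i`: the equivalence relation whose classes are the
fibers `M i`. -/
def eqClassStructure (M : O → Type) : langE.Structure (Σₗ i, M i) where
  funMap := fun f _ => Empty.elim f
  RelMap := fun {n} r v =>
    match n, r, v with
    | _, EqSymb.E, v => (ofLex (v 0)).1 = (ofLex (v 1)).1

/-- Interpretation of the predicates `P i` on `Σₗ i, M i`: `P i` names the fiber `M i`. -/
def predStructure (M : O → Type) : (langP O).Structure (Σₗ i, M i) where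
  funMap := fun f _ => Empty.elim f
  RelMap := fun {n} r v =>
    match n, r, v with
    | _, PredSymb.P i, v => (ofLex (v 0)).1 = i

/-- The language of `U_{i ∈ O}(M_i)`: the (common) language of the `M_i`, the order `<`,
and the unary predicates `P_i`. -/
def langU (L1 : Language) (O : Type) : Language := (L1.sum Language.order).sum (langP O)

/-- The structure `U_{i ∈ O}(M_i)` on the disjoint union `Σₗ i, M i`: relations of `L1` are
computed fiberwise, `<` is the lexicographic order (fibers are convex, ordered by `O`), and
`P i` names the fiber `M i`. -/
instance uStructure (L1 : Language) [L1.IsRelational] (M : O → Type)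
    [∀ i, L1.Structure (M i)] [∀ i, LinearOrder (M i)] :
    (langU L1 O).Structure (Σₗ i, M i) :=
  letI := fiberStructure O L1 M
  letI := predStructure O M
  inferInstanceAs (((L1.sum Language.order).sum (langP O)).Structure (Σₗ i, M i))

/-- The language `L1 ∪ {<} ∪ {E}` (the reduct language of a semi-direct product, and the
language of `O(M_i | i ∈ I)` when the index structure is a pure linear order). -/
def langRed (L1 : Language) : Language := (L1.sum Language.order).sum langE

/-- The `L1 ∪ {<} ∪ {E}`-structure on `Σₗ i, M i`: relations of `L1` fiberwise, `<` the
lexicographic order, `E` the equivalence relation whose classes are the fibers.  For a pure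
linear order index this is the structure `O(M_i | i ∈ O)`. -/
instance redStructure (L1 : Language) [L1.IsRelational] (M : O → Type)
    [∀ i, L1.Structure (M i)] [∀ i, LinearOrder (M i)] :
    (langRed L1).Structure (Σₗ i, M i) :=
  letI := fiberStructure O L1 M
  letI := eqClassStructure O M
  inferInstanceAs (((L1.sum Language.order).sum langE).Structure (Σₗ i, M i))

/-- The language `L2 ∪ L1 ∪ {E}` (with the shared order `<`) of a semi-direct product
structure. -/
def langSD (L1 L2 : Language) : Language := (langRed L1).sum L2

/-- The semi-direct product structure `𝕀 = I-script_{i ∈ I}(M_i)` on `Σₗ i, M i`: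
relations of `L1` fiberwise, `<` the lexicographic order, `E` the fiber equivalence
relation, and relations of `L2` computed from the index structure via the projection. -/
instance sdStructure (L2 : Language) [L2.IsRelational] [L2.Structure O]
    (L1 : Language) [L1.IsRelational] (M : O → Type)
    [∀ i, L1.Structure (M i)] [∀ i, LinearOrder (M i)] :
    (langSD L1 L2).Structure (Σₗ i, M i) :=
  letI := projStructure O L2 M
  inferInstanceAs (((langRed L1).sum L2).Structure (Σₗ i, M i))

end Constructions

/-- The underlying set of the "underlying graph" `gr(ā)` of a tuple from a semi-direct
product structure: the set of indices whose fiber meets the tuple. -/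
def grSet {O : Type} {M : O → Type} {n : ℕ} (a : Fin n → (Σₗ i, M i)) : Set O :=
  {t | ∃ k, (ofLex (a k)).1 = t}

/-- The full language of ordered graphs: one binary relation and the order. -/
def langOG : Language := langGr.sum Language.order

/-- A finite or countable `langOG`-structure is an ordered graph when the binary relation is
irreflexive and symmetric and the order symbol is interpreted as a linear order. -/
def IsOrderedGraph (N : Type*) [langOG.Structure N] : Prop :=
  (∀ x : N, ¬ Structure.RelMap (L := langOG) (Sum.inl GrSymb.adj) ![x, x]) ∧
  (∀ x y : N, Structure.RelMap (L := langOG) (Sum.inl GrSymb.adj) ![x, y] →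
    Structure.RelMap (L := langOG) (Sum.inl GrSymb.adj) ![y, x]) ∧
  IsLinearOrder N (fun a b =>
    Structure.RelMap (L := langOG) (Sum.inr Language.orderRel.le) ![a, b])

/-- A random ordered graph: a countable structure that is a Fraïssé limit of the class of
finite ordered graphs. -/
def IsRandomOrderedGraph (G : Type) [langGr.Structure G] [LinearOrder G] [Countable G] : Prop :=
  letI : langOG.Structure G := inferInstanceAs ((langGr.sum Language.order).Structure G)
  haveI : ∀ l, IsEmpty (langOG.Functions l) := fun _ => inferInstanceAs (IsEmpty (Empty ⊕ Empty))
  IsFraisseLimit {N : CategoryTheory.Bundled langOG.Structure | Finite N ∧ IsOrderedGraph N} G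

end SRPaper

attribute [local instance] FirstOrder.Language.orderStructure

namespace SDRamsey

open SRPaper

universe u v ua va

section Generic

variable {L : FirstOrder.Language.{u, v}}

/-- Embedding form of the Ramsey property. -/
def ERP (L : FirstOrder.Language.{u, v}) (K : Set (Bundled.{0} L.Structure)) : Prop :=
  ∀ A B : Bundled.{0} L.Structure, A ∈ K → B ∈ K → ∀ (κ : Type) [Finite κ],
    ∃ C : Bundled.{0} L.Structure, C ∈ K ∧ ∀ c : (A ↪[L] C) → κ,
      ∃ f : B ↪[L] C, ∀ g h : A ↪[L] B, c (f.comp g) = c (f.comp h)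

instance finiteEmb (A B : Type) [L.Structure A] [L.Structure B] [Finite A] [Finite B] :
    Finite (A ↪[L] B) :=
  Finite.of_injective (fun f : A ↪[L] B => (f : A → B)) DFunLike.coe_injective

theorem ERP.ramsey {K : Set (Bundled.{0} L.Structure)} (h : ERP L K) : RamseyClass L K := by
  intro A B hA hB k _
  obtain ⟨C, hC, H⟩ := h A B hA hB (Fin k)
  refine ⟨C, hC, fun c => ?_⟩
  obtain ⟨f, hf⟩ := H fun e => c e.toHom.range
  refine ⟨f.toHom.range, ⟨f.equivRange⟩, ?_⟩
  have key : ∀ A' : L.Substructure C, A' ≤ f.toHom.range → Nonempty (A ≃[L] A') →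
      ∃ g : A ↪[L] B, (f.comp g).toHom.range = A' := by
    rintro A' hA' ⟨e⟩
    refine ⟨f.equivRange.symm.toEmbedding.comp
      ((Substructure.inclusion hA').comp e.toEmbedding), ?_⟩
    have : ∀ a, f (f.equivRange.symm (Substructure.inclusion hA' (e a))) = e a := by
      intro a
      rw [← Embedding.equivRange_apply, FirstOrder.Language.Equiv.apply_symm_apply]
      rfl
    ext x
    simp only [Hom.mem_range]
    constructor
    · rintro ⟨a, rfl⟩
      have := this a
      change f (f.equivRange.symm (Substructure.inclusion hA' (e a))) ∈ A'
      rw [this]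
      exact (e a).2
    · intro hx
      refine ⟨e.symm ⟨x, hx⟩, ?_⟩
      refine (this _).trans ?_
      simp
  intro A₁ A₂ h1 h2 e1 e2
  obtain ⟨g1, rfl⟩ := key A₁ h1 e1
  obtain ⟨g2, rfl⟩ := key A₂ h2 e2
  exact hf g1 g2

/-- Rigid classes: an embedding is determined by its range. -/
def RigidClass (L : FirstOrder.Language.{u, v}) (K : Set (Bundled.{0} L.Structure)) : Prop :=
  ∀ A C : Bundled.{0} L.Structure, A ∈ K → C ∈ K → ∀ g h : A ↪[L] C,
    Set.range g = Set.range h → g = h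

theorem erp_of_ramsey {K : Set (Bundled.{0} L.Structure)} (h : RamseyClass L K)
    (hr : RigidClass L K) : ERP L K := by
  classical
  intro A B hA hB κ _
  obtain ⟨n, ⟨eκ⟩⟩ := Finite.exists_equiv_fin (Option κ)
  have hn : 1 ≤ n := by
    have := (eκ none).2
    omega
  obtain ⟨C, hC, H⟩ := h A B hA hB n hn
  refine ⟨C, hC, fun c => ?_⟩
  obtain ⟨B', ⟨e⟩, hB'⟩ := H fun A' =>
    if hh : ∃ g : A ↪[L] C, g.toHom.range = A' then eκ (some (c hh.choose)) else eκ none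
  have val : ∀ g : A ↪[L] C, (if hh : ∃ g' : A ↪[L] C, g'.toHom.range = g.toHom.range
      then eκ (some (c hh.choose)) else eκ none) = eκ (some (c g)) := by
    intro g
    have hh : ∃ g' : A ↪[L] C, g'.toHom.range = g.toHom.range := ⟨g, rfl⟩
    rw [dif_pos hh]
    have : hh.choose = g := hr A C hA hC _ _ (by
      have := congrArg (fun S : L.Substructure C => (S : Set C)) hh.choose_spec
      exact this)
    rw [this]
  refine ⟨B'.subtype.comp e.toEmbedding, fun g h => ?_⟩
  have hle : ∀ g : A ↪[L] B, ((B'.subtype.comp e.toEmbedding).comp g).toHom.range ≤ B' := by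
    rintro g x ⟨a, rfl⟩
    exact (e (g a)).2
  have := hB' _ _ (hle g) (hle h) ⟨Embedding.equivRange _⟩ ⟨Embedding.equivRange _⟩
  rw [val, val] at this
  simpa using this

/-- Ramsey property for finitely many small structures simultaneously. -/
theorem ERP.multi {K : Set (Bundled.{0} L.Structure)} (h : ERP L K) (P : Type) [Finite P] :
    ∀ (A : P → Bundled.{0} L.Structure) (B : Bundled.{0} L.Structure), (∀ p, A p ∈ K) → B ∈ K →
    ∀ (κ : P → Type) [∀ p, Finite (κ p)],
    ∃ C : Bundled.{0} L.Structure, C ∈ K ∧ ∀ c : ∀ p, (A p ↪[L] C) → κ p,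
      ∃ f : B ↪[L] C, ∀ p, ∀ g h : A p ↪[L] B, c p (f.comp g) = c p (f.comp h) := by
  induction P using Finite.induction_empty_option with
  | of_equiv e ih =>
    intro A B hA hB κ _
    obtain ⟨C, hC, H⟩ := ih (fun p => A (e p)) B (fun p => hA _) hB (fun p => κ (e p))
    refine ⟨C, hC, fun c => ?_⟩
    obtain ⟨f, hf⟩ := H fun p => c (e p)
    refine ⟨f, fun p => ?_⟩
    obtain ⟨q, rfl⟩ := e.surjective p
    exact hf q
  | h_empty =>
    intro A B hA hB κ _
    exact ⟨B, hB, fun c => ⟨Embedding.refl L B, fun p => p.elim⟩⟩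
  | h_option ih =>
    intro A B hA hB κ _
    obtain ⟨C₁, hC₁, H₁⟩ := ih (fun p => A (some p)) B (fun p => hA _) hB (fun p => κ (some p))
    obtain ⟨C, hC, H⟩ := h (A none) C₁ (hA _) hC₁ (κ none)
    refine ⟨C, hC, fun c => ?_⟩
    obtain ⟨f, hf⟩ := H (c none)
    obtain ⟨f₁, hf₁⟩ := H₁ fun p g => c (some p) (f.comp g)
    refine ⟨f.comp f₁, fun p => ?_⟩
    cases p with
    | none =>
      intro g h
      rw [Embedding.comp_assoc, Embedding.comp_assoc]
      exact hf _ _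
    | some p =>
      intro g h
      rw [Embedding.comp_assoc, Embedding.comp_assoc]
      exact hf₁ p g h

/-- Extending a family to `Option`. -/
def optB {α : Type} (D₀ : Bundled.{0} L.Structure) (D : α → Bundled.{0} L.Structure) :
    Option α → Bundled.{0} L.Structure
  | none => D₀
  | some a => D a

/-- Extending a family of embeddings to `Option`. -/
def optMk {α : Type} {D₀ : Bundled.{0} L.Structure} {D : α → Bundled.{0} L.Structure}
    {X : Option α → Bundled.{0} L.Structure} (g₀ : X none ↪[L] D₀)
    (g : ∀ t, X (some t) ↪[L] D t) : ∀ o, X o ↪[L] (optB D₀ D o)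
  | none => g₀
  | some t => g t

/-- Product Ramsey theorem with finitely many patterns. -/
theorem ERP.prod {K : Set (Bundled.{0} L.Structure)} (h : ERP L K)
    (hfin : ∀ A ∈ K, Finite A) (P : Type) [Finite P] (T : Type) [Finite T] :
    ∀ (A : P → T → Bundled.{0} L.Structure) (B : T → Bundled.{0} L.Structure),
    (∀ p t, A p t ∈ K) → (∀ t, B t ∈ K) →
    ∀ (κ : P → Type) [∀ p, Finite (κ p)],
    ∃ D : T → Bundled.{0} L.Structure, (∀ t, D t ∈ K) ∧
      ∀ c : ∀ p, (∀ t, A p t ↪[L] D t) → κ p,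
      ∃ f : ∀ t, B t ↪[L] D t, ∀ p, ∀ g h : ∀ t, A p t ↪[L] B t,
        c p (fun t => (f t).comp (g t)) = c p (fun t => (f t).comp (h t)) := by
  classical
  induction T using Finite.induction_empty_option with
  | of_equiv e ih =>
    intro A B hA hB κ _
    obtain ⟨D, hD, H⟩ := ih (fun p t => A p (e t)) (fun t => B (e t)) (fun p t => hA _ _)
      (fun t => hB _) κ
    have key : ∃ D' : _ → Bundled.{0} L.Structure, ∀ t, D' (e t) = D t :=
      ⟨fun s => D (e.symm s), fun t => by simp⟩
    obtain ⟨D', hD'⟩ := key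
    obtain rfl : (fun t => D' (e t)) = D := funext hD'
    refine ⟨D', fun s => ?_, fun c => ?_⟩
    · obtain ⟨t, rfl⟩ := e.surjective s
      exact hD t
    · obtain ⟨f, hf⟩ := H fun p g => c p (e.piCongrLeft (fun s => A p s ↪[L] D' s) g)
      refine ⟨e.piCongrLeft (fun s => B s ↪[L] D' s) f, fun p g h => ?_⟩
      have aux : ∀ g : ∀ s, A p s ↪[L] B s,
          (fun s => ((e.piCongrLeft (fun s => B s ↪[L] D' s) f) s).comp (g s)) =
          e.piCongrLeft (fun s => A p s ↪[L] D' s) (fun t => (f t).comp (g (e t))) := by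
        intro g
        funext s
        obtain ⟨t, rfl⟩ := e.surjective s
        rw [Equiv.piCongrLeft_apply_apply, Equiv.piCongrLeft_apply_apply]
      rw [aux, aux]
      exact hf p (fun t => g (e t)) (fun t => h (e t))
  | h_empty =>
    intro A B hA hB κ _
    refine ⟨fun t => t.elim, fun t => t.elim, fun c => ⟨fun t => t.elim, fun p g h => ?_⟩⟩
    congr 1
    funext t
    exact t.elim
  | @h_option α _ ih =>
    intro A B hA hB κ _
    obtain ⟨D₀, hD₀, H₀⟩ := h.multi P (fun p => A p none) (B none) (fun p => hA _ _) (hB _)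
      (fun p => Option (κ p))
    have := hfin _ hD₀
    have := fun p => hfin _ (hA p none)
    obtain ⟨D, hD, H⟩ := ih (fun p t => A p (some t)) (fun t => B (some t)) (fun p t => hA _ _)
      (fun t => hB _) (fun p => (A p none ↪[L] D₀) → κ p)
    refine ⟨optB D₀ D, fun o => ?_, fun c => ?_⟩
    · cases o
      · exact hD₀
      · exact hD _
    · let mk := @optMk L α D₀ D
      obtain ⟨f, hf⟩ := H fun p g e => c p (mk (X := A p) e g)
      obtain ⟨f₀, hf₀⟩ := H₀ fun p e =>
        if hh : Nonempty (∀ t, A p (some t) ↪[L] B (some t)) then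
          some (c p (mk (X := A p) e fun t => (f t).comp (hh.some t))) else none
      refine ⟨mk (X := B) f₀ f, fun p => ?_⟩
      have aux : ∀ g : ∀ o, A p o ↪[L] B o,
          (fun o => (mk (X := B) f₀ f o).comp (g o)) =
            mk (X := A p) (f₀.comp (g none)) (fun t => (f t).comp (g (some t))) := by
        intro g
        funext o
        cases o <;> rfl
      intro g h
      rw [aux, aux]
      have hh : Nonempty (∀ t, A p (some t) ↪[L] B (some t)) := ⟨fun t => g (some t)⟩
      have h1 := hf₀ p (g none) (h none)
      rw [dif_pos hh, dif_pos hh] at h1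
      have h1 := Option.some.inj h1
      have h2 := congrFun (hf p (fun t => g (some t)) hh.some) (f₀.comp (g none))
      have h3 := congrFun (hf p (fun t => h (some t)) hh.some) (f₀.comp (h none))
      exact h2.trans (h1.trans h3.symm)

/-- Embeddings between relational structures. -/
def mkEmb [L.IsRelational] {A B : Type*} [L.Structure A] [L.Structure B] (f : A → B)
    (hi : Function.Injective f)
    (hr : ∀ (n : ℕ) (r : L.Relations n) (v : Fin n → A), RelMap r (f ∘ v) ↔ RelMap r v) :
    A ↪[L] B where
  toFun := f
  inj' := hi
  map_fun' F := isEmptyElim F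
  map_rel' r v := hr _ r v

/-- Any subset of a relational structure is a substructure. -/
def subOf [L.IsRelational] {N : Type*} [L.Structure N] (s : Set N) : L.Substructure N where
  carrier := s
  fun_mem F := isEmptyElim F

theorem mem_age_of {N : Type} [L.Structure N] {A : Bundled.{0} L.Structure} (hf : Finite A)
    (e : A ↪[L] N) : A ∈ L.age N :=
  ⟨Structure.FG.of_finite, ⟨e⟩⟩

/-- The order symbol. -/
def leS (L : FirstOrder.Language.{u, v}) : (L.sum Language.order).Relations 2 :=
  Sum.inr Language.orderRel.le

theorem rigid_age [L.IsRelational] (N : Type) [LinearOrder N]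
    [(L.sum Language.order).Structure N]
    (hle : ∀ v : Fin 2 → N, RelMap (L := L.sum Language.order)
      (leS L) v ↔ v 0 ≤ v 1) :
    RigidClass (L.sum Language.order) ((L.sum Language.order).age N) := by
  rintro A C ⟨hA, -⟩ ⟨-, ⟨e⟩⟩ g h hgh
  have : Finite A := Structure.FG.finite hA
  letI : LinearOrder A := LinearOrder.lift' (e.comp g) (e.comp g).injective
  have mono : ∀ g' : A ↪[L.sum Language.order] N, ∀ a b, g' a ≤ g' b ↔
      RelMap (L := L.sum Language.order) (leS L) ![a, b] := by
    intro g' a b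
    exact (hle ![g' a, g' b]).symm.trans
      ((iff_of_eq (congrArg _ (by funext i; fin_cases i <;> rfl))).trans
        (g'.map_rel (leS L) ![a, b]))
  have h1 : StrictMono (e.comp g) := fun a b hab => hab
  have h2 : StrictMono (e.comp h) := by
    intro a b hab
    have : e.comp g a < e.comp g b := hab
    rw [← not_le, mono] at this ⊢
    exact this
  have h3 : Set.range (e.comp g) = Set.range (e.comp h) := by
    have : ∀ g : A ↪[L.sum Language.order] C, Set.range (e.comp g) = e '' Set.range g := by
      intro g
      rw [← Set.range_comp]
      rfl
    rw [this, this, hgh]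
  have h4 := (h1.range_inj h2).1 h3
  ext a
  exact e.injective (congrFun h4 a)

end Generic

section SD

variable {I : Type} [LinearOrder I]
  {L2 : FirstOrder.Language.{u, v}} [L2.IsRelational] [L2.Structure I]
  {L1 : FirstOrder.Language.{ua, va}} [L1.IsRelational] {M : I → Type}
  [∀ i, L1.Structure (M i)] [∀ i, LinearOrder (M i)]

instance relE : langE.IsRelational := fun _ => inferInstanceAs (IsEmpty Empty)

instance relSD (L1 : FirstOrder.Language.{ua, va}) (L2 : FirstOrder.Language.{u, v})
    [L1.IsRelational] [L2.IsRelational] : (langSD L1 L2).IsRelational :=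
  inferInstanceAs (((L1.sum Language.order).sum langE).sum L2).IsRelational

/-- Fiber relations in the big language. -/
def ra (L2 : FirstOrder.Language.{u, v}) {n : ℕ} (r : (L1.sum Language.order).Relations n) :
    (langSD L1 L2).Relations n :=
  Sum.inl (Sum.inl r)

/-- The relation `E` in the big language. -/
def re (L1 : FirstOrder.Language.{ua, va}) (L2 : FirstOrder.Language.{u, v}) :
    (langSD L1 L2).Relations 2 :=
  Sum.inl (Sum.inr EqSymb.E)

/-- Base relations in the big language. -/
def rb (L1 : FirstOrder.Language.{ua, va}) {n : ℕ} (r : L2.Relations n) :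
    (langSD L1 L2).Relations n :=
  Sum.inr r

/-- Projection to the base. -/
def pr (z : Σₗ i, M i) : I := (ofLex z).1

/-- Element of the product. -/
def el (i : I) (x : M i) : Σₗ i, M i := toLex ⟨i, x⟩

theorem exists_el {z : Σₗ i, M i} {i : I} (h : pr z = i) : ∃ x : M i, z = el i x := by
  subst h
  exact ⟨(ofLex z).2, rfl⟩

@[simp] theorem pr_el (i : I) (x : M i) : pr (el i x) = i := rfl

theorem el_inj {i : I} {x y : M i} (h : el i x = el i y) : x = y := by
  have h : (⟨i, x⟩ : Sigma M) = ⟨i, y⟩ := h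
  simpa using h

theorem rel_rb {n : ℕ} (r : L2.Relations n) (z : Fin n → Σₗ i, M i) :
    RelMap (rb L1 r) z ↔ RelMap r (fun k => pr (z k)) := Iff.rfl

theorem rel_re (z : Fin 2 → Σₗ i, M i) :
    RelMap (re L1 L2) z ↔ pr (z 0) = pr (z 1) := Iff.rfl

theorem rel_le (z : Fin 2 → Σₗ i, M i) :
    RelMap (ra L2 (leS L1)) z ↔ z 0 ≤ z 1 := Iff.rfl

theorem rel_inl {n : ℕ} (r : L1.Relations n) (z : Fin n → Σₗ i, M i) :
    RelMap (ra L2 (Sum.inl r)) z ↔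
      ∃ (i : I) (w : Fin n → M i), (∀ k, z k = el i (w k)) ∧ RelMap r w := Iff.rfl

theorem base_le (v : Fin 2 → I) : RelMap (leS L2) v ↔ v 0 ≤ v 1 := Iff.rfl

theorem le_iff (z z' : Σₗ i, M i) :
    z ≤ z' ↔ pr z < pr z' ∨ (pr z = pr z' ∧ z ≤ z') := by
  constructor
  · intro h
    rcases Sigma.Lex.le_def.1 h with h' | ⟨h', -⟩
    · exact Or.inl h'
    · exact Or.inr ⟨h', h⟩
  · rintro (h | h)
    · exact Sigma.Lex.le_def.2 (Or.inl h)
    · exact h.2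

theorem pr_le_iff (z z' : Σₗ i, M i) : pr z ≤ pr z' ↔ z ≤ z' ∨ pr z = pr z' := by
  rw [le_iff, le_iff_lt_or_eq]
  tauto

theorem el_le (i : I) (x y : M i) : el i x ≤ el i y ↔ x ≤ y := by
  constructor
  · intro h
    rcases Sigma.Lex.le_def.1 h with h' | ⟨_, h'⟩
    · exact absurd h' (lt_irrefl i)
    · exact h'
  · intro h
    exact Sigma.Lex.le_def.2 (Or.inr ⟨rfl, h⟩)

theorem nullary {K : Set (Bundled.{0} (L1.sum Language.order).Structure)}
    (hK : ∀ i, (L1.sum Language.order).age (M i) = K) (i j : I) (r : L1.Relations 0)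
    (w : Fin 0 → M i) (w' : Fin 0 → M j) (h : RelMap r w) : RelMap r w' := by
  let S : (L1.sum Language.order).Substructure (M i) := subOf ∅
  have : IsEmpty S := ⟨fun x => x.2⟩
  have hS : (⟨S, inferInstance⟩ : Bundled.{0} (L1.sum Language.order).Structure) ∈
      (L1.sum Language.order).age (M j) := by
    rw [hK j, ← hK i]
    exact mem_age_of (A := ⟨S, inferInstance⟩) (inferInstanceAs (Finite S)) S.subtype
  obtain ⟨-, ⟨e⟩⟩ := hS
  let r' : (L1.sum Language.order).Relations 0 := Sum.inl r
  have h1 : RelMap r' w := h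
  have h2 : RelMap r' (fun k : Fin 0 => (k.elim0 : S)) := by
    rw [← S.subtype.map_rel]
    convert h1
  have h3 := (e.map_rel r' (fun k : Fin 0 => (k.elim0 : S))).2 h2
  have h4 : RelMap r' w' := by
    convert h3
  exact h4

theorem fiber_rel {K : Set (Bundled.{0} (L1.sum Language.order).Structure)}
    (hK : ∀ i, (L1.sum Language.order).age (M i) = K) {n : ℕ}
    (r : (L1.sum Language.order).Relations n) (i : I) (w : Fin n → M i)
    (z : Fin n → Σₗ i, M i) (hz : ∀ k, z k = el i (w k)) :
    RelMap (ra L2 r) z ↔ RelMap r w := by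
  rcases r with r | r
  · rw [rel_inl]
    constructor
    · rintro ⟨j, w', hw', hr⟩
      cases n with
      | zero => exact nullary hK j i r w' w hr
      | succ n =>
        have hij : i = j := by
          have := congrArg pr ((hz 0).symm.trans (hw' 0))
          exact this
        subst hij
        have : w = w' := funext fun k => el_inj ((hz k).symm.trans (hw' k))
        subst this
        exact hr
    · intro h
      exact ⟨i, w, hz, h⟩
  · cases r
    refine (rel_le z).trans ?_
    rw [hz, hz, el_le]
    exact Iff.rfl

/-- Two maps into the semi-direct product agreeing on base and on fibers induce the
same structure. -/
theorem key_rel {A : Type} (F G : A → Σₗ i, M i)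
    (h1 : ∀ (n : ℕ) (r : (L2.sum Language.order).Relations n) (v : Fin n → A),
      RelMap r (fun k => pr (F (v k))) ↔ RelMap r (fun k => pr (G (v k))))
    (h2 : ∀ (n : ℕ) (r : (L1.sum Language.order).Relations n) (v : Fin n → A),
      (∀ j k, pr (G (v j)) = pr (G (v k))) →
      (RelMap (ra L2 r) (fun k => F (v k)) ↔ RelMap (ra L2 r) (fun k => G (v k))))
    (n : ℕ) (r : (langSD L1 L2).Relations n) (v : Fin n → A) :
    RelMap r (fun k => F (v k)) ↔ RelMap r (fun k => G (v k)) := by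
  have hle : ∀ a b, pr (F a) ≤ pr (F b) ↔ pr (G a) ≤ pr (G b) := fun a b =>
    h1 2 (leS L2) ![a, b]
  have heq : ∀ a b, pr (F a) = pr (F b) ↔ pr (G a) = pr (G b) := by
    intro a b
    rw [le_antisymm_iff, le_antisymm_iff, hle, hle]
  rcases r with (r | r) | r
  · rcases r with r | r
    · by_cases h : ∀ j k, pr (G (v j)) = pr (G (v k))
      · exact h2 n (Sum.inl r) v h
      · refine (rel_inl (L2 := L2) r _).trans (Iff.trans ?_ (rel_inl (L2 := L2) r _).symm)
        refine iff_of_false ?_ ?_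
        · rintro ⟨i, w, hw, -⟩
          apply h
          intro j k
          rw [← heq, hw, hw]
          rfl
        · rintro ⟨i, w, hw, -⟩
          apply h
          intro j k
          rw [hw, hw]
          rfl
    · cases r
      change F (v 0) ≤ F (v 1) ↔ G (v 0) ≤ G (v 1)
      rw [le_iff, le_iff (G _), lt_iff_not_ge, lt_iff_not_ge, hle, heq]
      refine or_congr Iff.rfl (and_congr_right fun h => ?_)
      refine h2 2 (leS L1) ![v 0, v 1] ?_
      intro j k
      fin_cases j <;> fin_cases k <;> first | rfl | exact h | exact h.symm
  · cases r
    exact heq _ _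
  · exact h1 n (Sum.inl r) v


section Emb

variable {A : Type} [(langSD L1 L2).Structure A] (α : A ↪[langSD L1 L2] (Σₗ i, M i))

theorem emb_rel {n : ℕ} (r : (langSD L1 L2).Relations n) (v : Fin n → A) :
    RelMap r (fun k => α (v k)) ↔ RelMap r v := α.map_rel r v

theorem emb_le (a b : A) : RelMap (ra L2 (leS L1)) ![a, b] ↔ α a ≤ α b := by
  rw [← emb_rel α, rel_le]
  rfl

theorem emb_re (a b : A) : RelMap (re L1 L2) ![a, b] ↔ pr (α a) = pr (α b) := by
  rw [← emb_rel α, rel_re]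
  rfl

/-- A relation-preserving map is an embedding. -/
def embOf (C : (langSD L1 L2).Substructure (Σₗ i, M i)) (F : A → Σₗ i, M i)
    (hC : ∀ a, F a ∈ C)
    (h : ∀ (n : ℕ) (r : (langSD L1 L2).Relations n) (v : Fin n → A),
      RelMap r (fun k => F (v k)) ↔ RelMap r (fun k => α (v k))) :
    A ↪[langSD L1 L2] C :=
  mkEmb (fun a => ⟨F a, hC a⟩) (by
    have hle : ∀ a b, F a ≤ F b ↔ α a ≤ α b := fun a b => h 2 (ra L2 (leS L1)) ![a, b]
    intro a b hab
    have hab : F a = F b := congrArg Subtype.val hab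
    apply α.injective
    exact le_antisymm ((hle a b).1 hab.le) ((hle b a).1 hab.ge))
    (fun n r v => (h n r v).trans (emb_rel α r v))

/-- The base of a substructure. -/
def baseS : (L2.sum Language.order).Substructure I := subOf (Set.range fun a => pr (α a))

/-- Projection to the base. -/
def bp (a : A) : baseS α := ⟨pr (α a), a, rfl⟩

theorem bp_surj (x : baseS α) : ∃ a, bp α a = x := by
  obtain ⟨x, a, rfl⟩ := x
  exact ⟨a, rfl⟩

theorem bp_eq {a b : A} : bp α a = bp α b ↔ pr (α a) = pr (α b) := Subtype.ext_iff

theorem base_rel {n : ℕ} (r : (L2.sum Language.order).Relations n) (v : Fin n → A) :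
    RelMap r (fun k => bp α (v k)) ↔ RelMap r (fun k => pr (α (v k))) := Iff.rfl

/-- The fiber structure on a subset of a structure in the big language. -/
@[reducible] def fibS (L1 : FirstOrder.Language.{ua, va}) (L2 : FirstOrder.Language.{u, v})
    [L1.IsRelational] (A : Type)
    [(langSD L1 L2).Structure A] (s : Set A) : (L1.sum Language.order).Structure s where
  funMap f _ := isEmptyElim f
  RelMap r v := RelMap (ra L2 r) (fun k => (v k : A))

/-- The bundled fiber structure. -/
def fib (L1 : FirstOrder.Language.{ua, va}) (L2 : FirstOrder.Language.{u, v})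
    [L1.IsRelational] (A : Type)
    [(langSD L1 L2).Structure A] (s : Set A) : Bundled.{0} (L1.sum Language.order).Structure :=
  ⟨s, fibS L1 L2 A s⟩

theorem fib_mem [Nonempty I] [Finite A]
    {K : Set (Bundled.{0} (L1.sum Language.order).Structure)}
    (hK : ∀ i, (L1.sum Language.order).age (M i) = K) (s : Set A)
    (hs : ∀ a ∈ s, ∀ b ∈ s, pr (α a) = pr (α b)) : fib L1 L2 A s ∈ K := by
  have : ∃ i, ∀ a ∈ s, pr (α a) = i := by
    rcases s.eq_empty_or_nonempty with rfl | ⟨a, ha⟩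
    · exact ⟨Classical.arbitrary I, by simp⟩
    · exact ⟨_, fun b hb => hs b hb a ha⟩
  obtain ⟨i, hi⟩ := this
  have : ∀ a : s, ∃ x : M i, α a = el i x := fun a => exists_el (hi a a.2)
  choose w hw using this
  rw [← hK i]
  letI := fibS L1 L2 A s
  refine mem_age_of (A := fib L1 L2 A s) (inferInstanceAs (Finite s))
    (mkEmb (A := s) w ?_ ?_)
  · intro a b hab
    apply Subtype.ext
    apply α.injective
    rw [hw, hw, hab]
  · intro n r v
    rw [← fiber_rel (L2 := L2) hK r i (w ∘ v) (fun k => α (v k)) (fun k => hw _)]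
    exact emb_rel α _ _

/-- `e` is an embedding on each fiber. -/
def FibEmb {X : Type} [(L1.sum Language.order).Structure X] (e : A → X) : Prop :=
  ∀ (n : ℕ) (r : (L1.sum Language.order).Relations n) (v : Fin n → A),
    (∀ j k, pr (α (v j)) = pr (α (v k))) →
    (RelMap r (fun k => e (v k)) ↔ RelMap (ra L2 r) v)

/-- Restriction of a fiberwise embedding to a fiber. -/
def FibEmb.restr {X : Type} [(L1.sum Language.order).Structure X] {e : A → X}
    (he : FibEmb α e) (s : Set A)
    (hs : ∀ a ∈ s, ∀ b ∈ s, pr (α a) = pr (α b)) :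
    fib L1 L2 A s ↪[L1.sum Language.order] X :=
  letI := fibS L1 L2 A s
  mkEmb (A := s) (fun a => e a) (by
    have key : ∀ a b : s, e a = e b → α a ≤ α b := by
      intro a b hab
      rw [← emb_le α]
      have h1 := he 2 (leS L1) ![(a : A), b] (by
        intro j k
        exact hs _ (by fin_cases j <;> simp) _ (by fin_cases k <;> simp))
      have h2 := he 2 (leS L1) ![(a : A), a] (by
        intro j k
        exact hs _ (by fin_cases j <;> simp) _ (by fin_cases k <;> simp))
      rw [← h1]
      have h3 : (fun k => e (![(a : A), b] k)) = (fun k => e (![(a : A), a] k)) := by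
        funext k
        fin_cases k
        · rfl
        · exact hab.symm
      rw [h3, h2, emb_le α]
    intro a b hab
    exact Subtype.ext (α.injective (le_antisymm (key a b hab) (key b a hab.symm))))
    (fun n r v => he n r (fun k => (v k : A)) fun j k => hs _ (v j).2 _ (v k).2)

end Emb

section Glue

variable {A : Type} [(langSD L1 L2).Structure A] (α : A ↪[langSD L1 L2] (Σₗ i, M i))
  {C₀ : Type} [(L2.sum Language.order).Structure C₀] (ι : C₀ ↪[L2.sum Language.order] I)
  {D : C₀ → Bundled.{0} (L1.sum Language.order).Structure}
  (δ : ∀ t, D t ↪[L1.sum Language.order] M (ι t))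

/-- The fiber of `A` over a point of `C₀`. -/
def fset (p : baseS α ↪[L2.sum Language.order] C₀) (t : C₀) : Set A := {a | p (bp α a) = t}

theorem fset_pr (p : baseS α ↪[L2.sum Language.order] C₀) (t : C₀) :
    ∀ a ∈ fset α p t, ∀ b ∈ fset α p t, pr (α a) = pr (α b) := by
  intro a ha b hb
  rw [← bp_eq]
  exact p.injective (ha.trans hb.symm)

/-- The big structure. -/
def bigC : (langSD L1 L2).Substructure (Σₗ i, M i) :=
  subOf (Set.range fun z : (Σ t, D t) => el (ι z.1) (δ z.1 z.2))

/-- Gluing embeddings of fibers over an embedding of bases. -/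
def glueFun (p : baseS α ↪[L2.sum Language.order] C₀)
    (g : ∀ t, fib L1 L2 A (fset α p t) ↪[L1.sum Language.order] D t) (a : A) : Σₗ i, M i :=
  el (ι (p (bp α a))) (δ _ (g (p (bp α a)) (⟨a, rfl⟩ : fset α p (p (bp α a)))))

/-- Gluing embeddings of fibers over an embedding of bases. -/
def glue {K : Set (Bundled.{0} (L1.sum Language.order).Structure)}
    (hK : ∀ i, (L1.sum Language.order).age (M i) = K)
    (p : baseS α ↪[L2.sum Language.order] C₀)
    (g : ∀ t, fib L1 L2 A (fset α p t) ↪[L1.sum Language.order] D t) :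
    A ↪[langSD L1 L2] bigC (L1 := L1) (L2 := L2) ι δ :=
  embOf α _ (glueFun α ι δ p g) (fun a => ⟨⟨p (bp α a), _⟩, rfl⟩) (by
    apply key_rel
    · intro n r v
      rw [← base_rel]
      exact ((ι.comp p).map_rel r (fun k => bp α (v k)))
    · intro n r v hv
      rcases Nat.eq_zero_or_pos n with rfl | hn
      · exact iff_of_eq (congrArg _ (Subsingleton.elim _ _))
      rw [emb_rel α]
      have : ∃ t, ∀ k, p (bp α (v k)) = t :=
        ⟨_, fun k => congrArg p ((bp_eq α).2 (hv k ⟨0, hn⟩))⟩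
      obtain ⟨t, ht⟩ := this
      have h1 : ∀ k, glueFun α ι δ p g (v k) =
          el (ι t) (δ t (g t (⟨v k, ht k⟩ : fset α p t))) := by
        intro k
        have := ht k
        subst this
        rfl
      rw [fiber_rel hK r (ι t) _ _ h1]
      exact ((δ t).comp (g t)).map_rel r (fun k => (⟨v k, ht k⟩ : fset α p t)))

theorem glue_coe {K : Set (Bundled.{0} (L1.sum Language.order).Structure)}
    (hK : ∀ i, (L1.sum Language.order).age (M i) = K)
    (p : baseS α ↪[L2.sum Language.order] C₀)
    (g : ∀ t, fib L1 L2 A (fset α p t) ↪[L1.sum Language.order] D t) (a : A) :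
    (glue α ι δ hK p g a : Σₗ i, M i) = glueFun α ι δ p g a := rfl

end Glue

theorem exists_bstar [Nonempty I] {B : Type} [Finite B] [(langSD L1 L2).Structure B]
    (β : B ↪[langSD L1 L2] (Σₗ i, M i))
    {K : Set (Bundled.{0} (L1.sum Language.order).Structure)}
    (hK : ∀ i, (L1.sum Language.order).age (M i) = K) :
    ∃ X : Bundled.{0} (L1.sum Language.order).Structure, X ∈ K ∧ ∃ ε : B → X, FibEmb β ε := by
  obtain ⟨i₀⟩ := ‹Nonempty I›
  have hI : Nonempty I := ⟨i₀⟩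
  have : ∀ i : I, Nonempty (fib L1 L2 B {b | pr (β b) = i} ↪[L1.sum Language.order] M i₀) := by
    intro i
    have := fib_mem β hK {b | pr (β b) = i} (fun a ha b hb => ha.trans hb.symm)
    rw [← hK i₀] at this
    exact this.2
  have e := fun i => (this i).some
  let ε : B → M i₀ := fun b => e (pr (β b)) (⟨b, rfl⟩ : {b' | pr (β b') = pr (β b)})
  let S : (L1.sum Language.order).Substructure (M i₀) := subOf (Set.range ε)
  have hS : Finite S := inferInstanceAs (Finite (Set.range ε))
  refine ⟨⟨S, inferInstance⟩, ?_, fun b => (⟨ε b, b, rfl⟩ : S), ?_⟩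
  · rw [← hK i₀]
    exact mem_age_of (A := ⟨S, inferInstance⟩) hS S.subtype
  · intro n r v hv
    change RelMap r (fun k => ε (v k)) ↔ _
    rcases Nat.eq_zero_or_pos n with rfl | hn
    · rw [← emb_rel β]
      exact (fiber_rel hK r i₀ _ _ (fun k => k.elim0)).symm
    · have h1 : ∀ k, pr (β (v k)) = pr (β (v ⟨0, hn⟩)) := fun k => hv _ _
      generalize pr (β (v ⟨0, hn⟩)) = i at h1
      have h2 : ∀ k, ε (v k) = e i (⟨v k, h1 k⟩ : {b' | pr (β b') = i}) := by
        intro k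
        have := h1 k
        subst this
        rfl
      rw [funext h2]
      exact (e i).map_rel r (fun k => (⟨v k, h1 k⟩ : {b' | pr (β b') = i}))

/-- An embedding induces an embedding of bases. -/
theorem exists_base {A B : Type} [(langSD L1 L2).Structure A] [(langSD L1 L2).Structure B]
    (α : A ↪[langSD L1 L2] (Σₗ i, M i)) (β : B ↪[langSD L1 L2] (Σₗ i, M i))
    (g : A ↪[langSD L1 L2] B) :
    ∃ g₀ : baseS α ↪[L2.sum Language.order] baseS β, ∀ a, g₀ (bp α a) = bp β (g a) := by
  choose sec hsec using bp_surj α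
  have hE : ∀ a b, pr (β (g a)) = pr (β (g b)) ↔ pr (α a) = pr (α b) := by
    intro a b
    rw [← emb_re α]
    exact (emb_re (β.comp g) a b).symm
  have hL : ∀ a b, β (g a) ≤ β (g b) ↔ α a ≤ α b := by
    intro a b
    rw [← emb_le α]
    exact (emb_le (β.comp g) a b).symm
  refine ⟨mkEmb (fun x => bp β (g (sec x))) ?_ ?_, ?_⟩
  · intro x y hxy
    rw [← hsec x, ← hsec y, bp_eq, ← hE, ← bp_eq]
    exact hxy
  · intro n r v
    have hv : v = fun k => bp α (sec (v k)) := funext fun k => (hsec _).symm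
    conv_rhs => rw [hv]
    refine (base_rel β r (fun k => g (sec (v k)))).trans
      (Iff.trans ?_ (base_rel α r (fun k => sec (v k))).symm)
    rcases r with r | r
    · refine (emb_rel (β.comp g) (rb L1 r) (fun k => sec (v k))).trans ?_
      exact (emb_rel α (rb L1 r) (fun k => sec (v k))).symm
    · cases r
      change pr (β (g (sec (v 0)))) ≤ pr (β (g (sec (v 1)))) ↔
        pr (α (sec (v 0))) ≤ pr (α (sec (v 1)))
      rw [pr_le_iff, pr_le_iff (α _), hE, hL]
  · intro a
    change bp β (g (sec (bp α a))) = _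
    rw [bp_eq, hE, ← bp_eq, hsec]

theorem erp_sd [Nonempty I]
    {K : Set (Bundled.{0} (L1.sum Language.order).Structure)}
    (hK : ∀ i, (L1.sum Language.order).age (M i) = K)
    (hI : ERP (L2.sum Language.order) ((L2.sum Language.order).age I))
    (hKR : ERP (L1.sum Language.order) K) :
    ERP (langSD L1 L2) ((langSD L1 L2).age (Σₗ i, M i)) := by
  classical
  rintro A B ⟨hA, ⟨α⟩⟩ ⟨hB, ⟨β⟩⟩ κ _
  have : Finite A := Structure.FG.finite hA
  have : Finite B := Structure.FG.finite hB
  have hfin : ∀ X ∈ K, Finite X := by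
    intro X hX
    rw [← hK (Classical.arbitrary I)] at hX
    exact Structure.FG.finite hX.1
  have base_mem : ∀ {A : Type} [Finite A] [(langSD L1 L2).Structure A]
      (α : A ↪[langSD L1 L2] (Σₗ i, M i)),
      (⟨baseS α, inferInstance⟩ : Bundled.{0} (L2.sum Language.order).Structure) ∈
        (L2.sum Language.order).age I := by
    intro A _ _ α
    exact mem_age_of (A := ⟨baseS α, inferInstance⟩)
      (inferInstanceAs (Finite (Set.range fun a => pr (α a)))) (baseS α).subtype
  obtain ⟨X, hX, ε, hε⟩ := exists_bstar β hK
  obtain ⟨C₀, ⟨hC₀, ⟨ι⟩⟩, H₀⟩ := hI _ _ (base_mem α) (base_mem β) (Option κ)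
  have : Finite C₀ := Structure.FG.finite hC₀
  have : Finite (baseS α) := Structure.FG.finite (base_mem α).1
  obtain ⟨D, hD, H⟩ := hKR.prod hfin (baseS α ↪[L2.sum Language.order] C₀) C₀
    (fun p t => fib L1 L2 A (fset α p t)) (fun _ => X)
    (fun p t => fib_mem α hK _ (fset_pr α p t)) (fun _ => hX) (fun _ => κ)
  have hδ : ∀ t, Nonempty (D t ↪[L1.sum Language.order] M (ι t)) := by
    intro t
    have := hD t
    rw [← hK (ι t)] at this
    exact this.2
  have δ := fun t => (hδ t).some
  have hDf : ∀ t, Finite (D t) := fun t => hfin _ (hD t)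
  refine ⟨⟨bigC (L1 := L1) (L2 := L2) ι δ, inferInstance⟩, ?_, fun c => ?_⟩
  · exact mem_age_of (A := ⟨bigC (L1 := L1) (L2 := L2) ι δ, inferInstance⟩)
      (inferInstanceAs (Finite (Set.range fun z : (Σ t, D t) => el (ι z.1) (δ z.1 z.2))))
      (bigC (L1 := L1) (L2 := L2) ι δ).subtype
  obtain ⟨f, hf⟩ := H fun p g => c (glue α ι δ hK p g)
  obtain ⟨f₀, hf₀⟩ := H₀ fun p =>
    if hh : Nonempty (∀ t, fib L1 L2 A (fset α p t) ↪[L1.sum Language.order] X) then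
      some (c (glue α ι δ hK p fun t => (f t).comp (hh.some t))) else none
  refine ⟨glue β ι δ hK f₀ fun t => (f t).comp (hε.restr β _ (fset_pr β f₀ t)), ?_⟩
  have key : ∀ g : A ↪[langSD L1 L2] B, ∃ g₀ : baseS α ↪[L2.sum Language.order] baseS β,
      some (c ((glue β ι δ hK f₀ fun t =>
        (f t).comp (hε.restr β _ (fset_pr β f₀ t))).comp g)) =
      if hh : Nonempty (∀ t, fib L1 L2 A (fset α (f₀.comp g₀) t) ↪[L1.sum Language.order] X) then
        some (c (glue α ι δ hK (f₀.comp g₀) fun t => (f t).comp (hh.some t))) else none := by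
    intro g
    obtain ⟨g₀, hg₀⟩ := exists_base α β g
    refine ⟨g₀, ?_⟩
    have hεg : FibEmb α (fun a => ε (g a)) := by
      intro n r v hv
      refine (hε n r (fun k => g (v k)) ?_).trans (g.map_rel _ v)
      intro j k
      rw [← bp_eq, ← hg₀, ← hg₀, (bp_eq α).2 (hv j k)]
    have hh : Nonempty (∀ t, fib L1 L2 A (fset α (f₀.comp g₀) t) ↪[L1.sum Language.order] X) :=
      ⟨fun t => hεg.restr α _ (fset_pr α _ t)⟩
    rw [dif_pos hh, ← hf (f₀.comp g₀) (fun t => hεg.restr α _ (fset_pr α _ t)) hh.some]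
    congr 2
    ext a
    change el (ι (f₀ (bp β (g a)))) (δ _ (f (f₀ (bp β (g a))) (ε (g a)))) =
      el (ι (f₀ (g₀ (bp α a)))) (δ _ (f (f₀ (g₀ (bp α a))) (ε (g a))))
    rw [hg₀]
  intro g h
  obtain ⟨g₀, hg₀⟩ := key g
  obtain ⟨h₀, hh₀⟩ := key h
  exact Option.some.inj (hg₀.trans ((hf₀ g₀ h₀).trans hh₀.symm))

end SD

theorem ramsey_of_isEmpty {L : FirstOrder.Language.{u, v}} (N : Type) [L.Structure N]
    [IsEmpty N] : RamseyClass L (L.age N) := by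
  rintro A B hA ⟨hB, ⟨β⟩⟩ k _
  have : IsEmpty B := ⟨fun b => isEmptyElim (β b)⟩
  refine ⟨B, ⟨hB, ⟨β⟩⟩, fun c => ⟨⊤, ⟨Substructure.topEquiv.symm⟩, ?_⟩⟩
  intro A₁ A₂ _ _ _ _
  congr 1
  ext x
  exact isEmptyElim x

end SDRamsey

open SRPaper in
/-- If the age of the index structure `𝓘` has the Ramsey property and the
common age `K` of the fibers has the Ramsey property, then the age of the semi-direct
product structure `𝓘_{i ∈ I}(M_i)` has the Ramsey property. -/
theorem statement13 (I : Type) [LinearOrder I] [Countable I]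
    (L2 : Language) [L2.IsRelational] [L2.Structure I]
    (L1 : Language) [L1.IsRelational] (M : I → Type)
    [∀ i, L1.Structure (M i)] [∀ i, LinearOrder (M i)] [∀ i, Countable (M i)]
    (K : Set (CategoryTheory.Bundled (L1.sum Language.order).Structure))
    (hK : ∀ i, (L1.sum Language.order).age (M i) = K)
    (hIRP : RamseyClass (L2.sum Language.order) ((L2.sum Language.order).age I))
    (hKRP : RamseyClass (L1.sum Language.order) K) :
    RamseyClass (langSD L1 L2) ((langSD L1 L2).age (Σₗ i, M i)) := by
  cases isEmpty_or_nonempty I with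
  | inl h =>
    haveI : IsEmpty (Σₗ i, M i) := ⟨fun z => h.elim (SDRamsey.pr z)⟩
    exact SDRamsey.ramsey_of_isEmpty _
  | inr h =>
    refine (SDRamsey.erp_sd hK ?_ ?_).ramsey
    · exact SDRamsey.erp_of_ramsey hIRP (SDRamsey.rigid_age I fun _ => Iff.rfl)
    · refine SDRamsey.erp_of_ramsey hKRP ?_
      rw [← hK (Classical.arbitrary I)]
      exact SDRamsey.rigid_age _ fun _ => Iff.rfl
end

section
/- Let I-script be a random ordered graph with underlying order I, and for each i in I let M_i be a countable ordered relational L-structure, all with the same age K. If K has the Ramsey property, then the structure R(M_i | i in I-script) := I-script_{i in I}(M_i) has the Ramsey property. -/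
open FirstOrder FirstOrder.Language FirstOrder.Language.Structure CategoryTheory

namespace SRPaper

/-! ### Disjoint unions and semi-direct product structures

An "ordered `L`-structure" is modelled as a type with an `L.Structure` instance (for the
relations other than `<`) together with a `LinearOrder` instance (interpreting `<`); its full
language is `L.sum Language.order`. -/

attribute [local instance] FirstOrder.Language.orderStructure

end SRPaper

attribute [local instance] FirstOrder.Language.orderStructure

namespace SRAux

/-! ### Finite Ramsey theorem -/

theorem ramsey_end {κ : Type} [Finite κ] (a : ℕ)
    (ih : ∀ n, ∃ p, ∀ S : Finset ℕ, p ≤ S.card → ∀ c : Finset ℕ → κ,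
      ∃ T ⊆ S, T.card = n ∧ ∃ col, ∀ e ⊆ T, e.card = a → c e = col) (m : ℕ) :
    ∃ p, ∀ S : Finset ℕ, p ≤ S.card → ∀ c : Finset ℕ → κ,
      ∃ T ⊆ S, T.card = m ∧ ∃ d : ℕ → κ, ∀ s ∈ T, ∀ e ⊆ T, (∀ x ∈ e, s < x) →
        e.card = a → c (insert s e) = d s := by
  classical
  induction m with
  | zero =>
    refine ⟨0, fun S _ c => ⟨∅, by simp, by simp, fun _ => c ∅, by simp⟩⟩
  | succ m ihm =>
    obtain ⟨p, hp⟩ := ihm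
    obtain ⟨q, hq⟩ := ih p
    refine ⟨q + 1, fun S hS c => ?_⟩
    have hne : S.Nonempty := Finset.card_pos.1 (by omega)
    set s := S.min' hne with hs
    have hsS : s ∈ S := S.min'_mem hne
    obtain ⟨S', hS', hS'c, col, hcol⟩ := hq (S.erase s)
      (by rw [Finset.card_erase_of_mem hsS]; omega) (fun e => c (insert s e))
    obtain ⟨T, hT, hTc, d, hd⟩ := hp S' hS'c.ge c
    have hlt : ∀ x ∈ T, s < x := fun x hx => by
      have := Finset.mem_erase.1 (hS' (hT hx))
      exact lt_of_le_of_ne (S.min'_le x this.2) (Ne.symm this.1)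
    have hsT : s ∉ T := fun h => lt_irrefl _ (hlt s h)
    refine ⟨insert s T, ?_, by rw [Finset.card_insert_of_notMem hsT, hTc],
      Function.update d s col, ?_⟩
    · intro x hx
      rcases Finset.mem_insert.1 hx with rfl | hx
      · exact hsS
      · exact Finset.mem_of_mem_erase (hS' (hT hx))
    · intro t ht e he hte hec
      have hse : s ∉ e := fun h => by
        have h1 := hte s h
        rcases Finset.mem_insert.1 ht with rfl | ht
        · exact lt_irrefl _ h1
        · exact lt_asymm h1 (hlt t ht)
      have heT : e ⊆ T := fun x hx => (Finset.mem_insert.1 (he hx)).resolve_left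
        (fun h => hse (h ▸ hx))
      rcases Finset.mem_insert.1 ht with rfl | ht
      · rw [Function.update_self]
        exact hcol e (heT.trans hT) hec
      · rw [Function.update_of_ne (hlt t ht).ne']
        exact hd t ht e heT hte hec

theorem ramsey {κ : Type} [Finite κ] (a n : ℕ) :
    ∃ p, ∀ S : Finset ℕ, p ≤ S.card → ∀ c : Finset ℕ → κ,
      ∃ T ⊆ S, T.card = n ∧ ∃ col, ∀ e ⊆ T, e.card = a → c e = col := by
  classical
  have := Fintype.ofFinite κ
  induction a generalizing n with
  | zero =>
    refine ⟨n, fun S hS c => ?_⟩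
    obtain ⟨T, hT, hc⟩ := Finset.exists_subset_card_eq hS
    refine ⟨T, hT, hc, c ∅, fun e _ he => ?_⟩
    rw [Finset.card_eq_zero.1 he]
  | succ a ih =>
    obtain ⟨p, hp⟩ := ramsey_end a ih (Fintype.card κ * n)
    refine ⟨p, fun S hS c => ?_⟩
    obtain ⟨T, hT, hTc, d, hd⟩ := hp S hS c
    have : Nonempty κ := ⟨c ∅⟩
    obtain ⟨col, -, hcol⟩ := Finset.exists_le_card_fiber_of_mul_le_card_of_maps_to
      (s := T) (t := (Finset.univ : Finset κ)) (f := d) (n := n) (by simp) (by simp)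
      (by rw [hTc]; simp)
    obtain ⟨T', hT', hc'⟩ := Finset.exists_subset_card_eq hcol
    refine ⟨T', fun x hx => hT (Finset.mem_filter.1 (hT' hx)).1, hc', col, fun e he hec => ?_⟩
    have hne : e.Nonempty := Finset.card_pos.1 (by omega)
    have hm := e.min'_mem hne
    have h1 := Finset.mem_filter.1 (hT' (he hm))
    have := hd _ h1.1 (e.erase (e.min' hne))
      (fun x hx => (Finset.mem_filter.1 (hT' (he (Finset.mem_of_mem_erase hx)))).1)
      (fun x hx => e.min'_lt_of_mem_erase_min' hne hx)
      (by rw [Finset.card_erase_of_mem hm]; omega)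
    rw [Finset.insert_erase hm] at this
    rw [this, h1.2]

/-- Ramsey's theorem for strictly monotone maps between finite linear orders. -/
theorem ramsey_mono {κ : Type} [Finite κ] [Nonempty κ] (T G : Type) [LinearOrder T] [Finite T]
    [LinearOrder G] [Finite G] :
    ∃ p : ℕ, ∀ χ : (T → Fin p) → κ, ∃ m : G → Fin p, StrictMono m ∧
      ∃ col, ∀ u : T → G, StrictMono u → χ (m ∘ u) = col := by
  classical
  have := Fintype.ofFinite T
  have := Fintype.ofFinite G
  obtain ⟨p, hp⟩ := ramsey (κ := κ) (Fintype.card T) (Fintype.card G)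
  refine ⟨p, fun χ => ?_⟩
  let c : Finset ℕ → κ := fun e =>
    if h : ∃ ε : T → Fin p, StrictMono ε ∧ Set.range (fun t => (ε t : ℕ)) = (e : Set ℕ)
    then χ h.choose else Classical.arbitrary κ
  obtain ⟨S, hS, hSc, col, hcol⟩ := hp (Finset.range p) (by simp) c
  let o := S.orderIsoOfFin hSc
  let o' := Fintype.orderIsoFinOfCardEq G rfl
  let m : G → Fin p := fun x => ⟨o (o'.symm x), Finset.mem_range.1 (hS (o (o'.symm x)).2)⟩
  have hm : StrictMono m := fun x y hxy => by
    have : o (o'.symm x) < o (o'.symm y) := by simpa using hxy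
    exact this
  refine ⟨m, hm, col, fun u hu => ?_⟩
  have hmu : StrictMono (m ∘ u) := hm.comp hu
  have hinj : Function.Injective (fun t => (m (u t) : ℕ)) :=
    Fin.val_injective.comp hmu.injective
  let e : Finset ℕ := Finset.univ.image (fun t => (m (u t) : ℕ))
  have he : ∃ ε : T → Fin p, StrictMono ε ∧ Set.range (fun t => (ε t : ℕ)) = (e : Set ℕ) :=
    ⟨m ∘ u, hmu, by simp [e]⟩
  have h1 : c e = χ (m ∘ u) := by
    simp only [c, dif_pos he]
    congr 1
    have hs := he.choose_spec
    apply (StrictMono.range_inj hs.1 hmu).1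
    apply Set.image_injective.2 Fin.val_injective
    rw [← Set.range_comp, ← Set.range_comp]
    refine hs.2.trans ?_
    simp only [e, Finset.coe_image, Finset.coe_univ, Set.image_univ]; rfl
  rw [← h1]
  apply hcol
  · intro x hx
    obtain ⟨t, -, rfl⟩ := Finset.mem_image.1 hx
    exact (o (o'.symm (u t))).2
  · rw [Finset.card_image_of_injective _ hinj, Finset.card_univ]

/-! ### The partite construction -/

/-- A `V`-partite finite graph. -/
structure Picture (V : Type) where
  P : Type
  fin : Finite P
  π : P → V
  R : P → P → Prop
  symm : ∀ x y, R x y → R y x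
  ne : ∀ x y, R x y → π x ≠ π y

/-- Embedding of partite graphs over the identity of `V`. -/
structure Picture.IsEmb {V : Type} (P Q : Picture V) (φ : P.P → Q.P) : Prop where
  proj : ∀ x, Q.π (φ x) = P.π x
  rel : ∀ x y, Q.R (φ x) (φ y) ↔ P.R x y

/-- Copies of `T` over `ε`. -/
def Picture.Copy {V T : Type} (adj : T → T → Prop) (ε : T → V) (P : Picture V) : Type :=
  {u : T → P.P // (∀ t, P.π (u t) = ε t) ∧ ∀ s t, P.R (u s) (u t) ↔ adj s t}

theorem partite_step {V T κ : Type} [Finite V] [Finite T] [Finite κ] (adj : T → T → Prop)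
    (hsymm : ∀ s t, adj s t → adj t s) (ε : T → V) (hε : Function.Injective ε)
    (P : Picture V) :
    ∃ Q : Picture V, ∀ χ : (T → Q.P) → κ, ∃ φ : P.P → Q.P, P.IsEmb Q φ ∧
      ∃ col, ∀ u : P.Copy adj ε, χ (φ ∘ u.1) = col := by
  classical
  have := P.fin
  have : Finite (P.Copy adj ε) := by unfold Picture.Copy; infer_instance
  obtain ⟨ι, _, hHJ⟩ := Combinatorics.Line.exists_mono_in_high_dimension (P.Copy adj ε) κ
  let NA : V → V → Prop := fun v w => ∃ s t, v = ε s ∧ w = ε t ∧ ¬ adj s t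
  have hNA : ∀ v w, NA v w → NA w v := fun v w ⟨s, t, h1, h2, h3⟩ =>
    ⟨t, s, h2, h1, fun h => h3 (hsymm _ _ h)⟩
  let Q : Picture V :=
    { P := V × (ι → Option P.P)
      fin := inferInstance
      π := Prod.fst
      R := fun q q' => q.1 ≠ q'.1 ∧
        (∃ l x y, q.2 l = some x ∧ q'.2 l = some y ∧ P.R x y) ∧
        (NA q.1 q'.1 ∨ ∀ l x y, q.2 l = some x → q'.2 l = some y → P.R x y)
      symm := by
        rintro q q' ⟨h1, ⟨l, x, y, h2, h3, h4⟩, h5⟩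
        refine ⟨h1.symm, ⟨l, y, x, h3, h2, P.symm _ _ h4⟩, ?_⟩
        rcases h5 with h5 | h5
        · exact Or.inl (hNA _ _ h5)
        · exact Or.inr fun l x y hx hy => P.symm _ _ (h5 l y x hy hx)
      ne := fun q q' h => h.1 }
  refine ⟨Q, fun χ => ?_⟩
  let word : (ι → P.Copy adj ε) → T → Q.P := fun w t => (ε t, fun l => some ((w l).1 t))
  obtain ⟨lam, col, hcol⟩ := hHJ (fun w => χ (word w))
  let ext : P.Copy adj ε → V → Option P.P := fun u v =>
    if h : ∃ t, ε t = v then some (u.1 h.choose) else none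
  have hext : ∀ u t, ext u (ε t) = some (u.1 t) := fun u t => by
    have h : ∃ t', ε t' = ε t := ⟨t, rfl⟩
    simp only [ext, dif_pos h]
    rw [hε h.choose_spec]
  have hext' : ∀ u v x, ext u v = some x → ∃ t, v = ε t ∧ x = u.1 t := fun u v x hx => by
    by_cases h : ∃ t, ε t = v
    · obtain ⟨t, rfl⟩ := h
      rw [hext] at hx
      exact ⟨t, rfl, (Option.some_injective _ hx).symm⟩
    · simp [ext, dif_neg h] at hx
  let φ : P.P → Q.P := fun x => (P.π x, fun l => (lam.idxFun l).elim (some x) (fun u => ext u (P.π x)))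
  obtain ⟨l0, hl0⟩ := lam.proper
  have hφ0 : ∀ x, (φ x).2 l0 = some x := fun x => by simp [φ, hl0]
  refine ⟨φ, ⟨fun x => rfl, fun x y => ⟨?_, ?_⟩⟩, col, fun u => ?_⟩
  · rintro ⟨-, ⟨l, x', y', hx, hy, h⟩, h5⟩
    rcases h5 with ⟨s, t, hs, ht, hst⟩ | h5
    · simp only [φ] at hx hy hs ht
      rcases hl : lam.idxFun l with _ | u
      · simp only [hl, Option.elim] at hx hy
        cases hx; cases hy; exact h
      · simp only [hl, Option.elim, hs, ht, hext] at hx hy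
        cases hx; cases hy
        exact absurd ((u.2.2 s t).1 h) hst
    · exact h5 l0 x y (hφ0 x) (hφ0 y)
  · intro h
    refine ⟨P.ne _ _ h, ⟨l0, x, y, hφ0 x, hφ0 y, h⟩, ?_⟩
    by_cases hn : NA (φ x).1 (φ y).1
    · exact Or.inl hn
    · refine Or.inr fun l x' y' hx hy => ?_
      simp only [φ] at hx hy
      rcases hl : lam.idxFun l with _ | u
      · simp only [hl, Option.elim] at hx hy
        cases hx; cases hy; exact h
      · simp only [hl, Option.elim] at hx hy
        obtain ⟨s, hs, rfl⟩ := hext' _ _ _ hx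
        obtain ⟨t, ht, rfl⟩ := hext' _ _ _ hy
        rw [u.2.2]
        by_contra hst
        exact hn ⟨s, t, hs, ht, hst⟩
  · rw [← hcol u]
    show χ _ = χ _
    congr 1
    funext t
    simp only [φ, word, Function.comp, u.2.1]
    congr 1
    funext l
    show _ = some (((lam.idxFun l).getD u).1 t)
    rcases hl : lam.idxFun l with _ | u'
    · rfl
    · exact hext _ _

theorem partite_iter {V T κ : Type} [Finite V] [Finite T] [Finite κ] (adj : T → T → Prop)
    (hsymm : ∀ s t, adj s t → adj t s) (P : Picture V) (E : List (T → V)) 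
    (hE : ∀ ε ∈ E, Function.Injective ε) :
    ∃ Q : Picture V, ∀ χ : (T → Q.P) → κ, ∃ φ : P.P → Q.P, P.IsEmb Q φ ∧
      ∀ ε ∈ E, ∃ col, ∀ u : P.Copy adj ε, χ (φ ∘ u.1) = col := by
  induction E with
  | nil => exact ⟨P, fun χ => ⟨id, ⟨fun _ => rfl, fun _ _ => Iff.rfl⟩, by simp⟩⟩
  | cons ε E ih =>
    obtain ⟨Q, hQ⟩ := ih (fun e he => hE e (List.mem_cons_of_mem _ he))
    obtain ⟨Q', hQ'⟩ := partite_step (κ := κ) adj hsymm ε (hE ε List.mem_cons_self) Q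
    refine ⟨Q', fun χ => ?_⟩
    obtain ⟨φ', hφ', col', hcol'⟩ := hQ' χ
    obtain ⟨φ, hφ, hcol⟩ := hQ (fun v => χ (φ' ∘ v))
    refine ⟨φ' ∘ φ, ⟨fun x => (hφ'.proj _).trans (hφ.proj _),
      fun x y => (hφ'.rel _ _).trans (hφ.rel _ _)⟩, fun e he => ?_⟩
    rcases List.mem_cons.1 he with rfl | he
    · refine ⟨col', fun u => ?_⟩
      exact hcol' ⟨φ ∘ u.1, fun t => (hφ.proj _).trans (u.2.1 t),
        fun s t => (hφ.rel _ _).trans (u.2.2 s t)⟩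
    · exact hcol e he

/-- The Ramsey theorem for finite ordered graphs. -/
theorem ordered_graph_ramsey {κ : Type} [Finite κ] [Nonempty κ] (T G : Type)
    [LinearOrder T] [Finite T] [LinearOrder G] [Finite G]
    (adjT : T → T → Prop) (hT : ∀ s t, adjT s t → adjT t s)
    (adjG : G → G → Prop) (hG : ∀ s t, adjG s t → adjG t s) (hG' : ∀ s, ¬ adjG s s) :
    ∃ (P : Type) (_ : LinearOrder P) (R : P → P → Prop), Finite P ∧
      (∀ x y, R x y → R y x) ∧ (∀ x, ¬ R x x) ∧
      ∀ χ : (T → P) → κ, ∃ f : G → P, StrictMono f ∧ (∀ x y, R (f x) (f y) ↔ adjG x y) ∧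
        ∃ col, ∀ u : T → G, StrictMono u → (∀ s t, adjG (u s) (u t) ↔ adjT s t) →
          χ (f ∘ u) = col := by
  classical
  obtain ⟨p, hp⟩ := ramsey_mono (κ := κ) T G
  let P0 : Picture (Fin p) :=
    { P := {m : G → Fin p // StrictMono m} × G
      fin := inferInstance
      π := fun q => q.1.1 q.2
      R := fun q q' => q.1 = q'.1 ∧ adjG q.2 q'.2
      symm := fun q q' h => ⟨h.1.symm, hG _ _ h.2⟩
      ne := by
        rintro ⟨m, x⟩ ⟨m', y⟩ ⟨h1, h2⟩ h
        obtain rfl : m = m' := h1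
        obtain rfl : x = y := m.2.injective h
        exact hG' _ h2 }
  have := Fintype.ofFinite {ε : T → Fin p // StrictMono ε}
  obtain ⟨Q, hQ⟩ := partite_iter (κ := κ) adjT hT P0
    ((Finset.univ : Finset {ε : T → Fin p // StrictMono ε}).toList.map Subtype.val) (by
      intro ε hε
      obtain ⟨e, -, rfl⟩ := List.mem_map.1 hε
      exact e.2.injective)
  have := Q.fin
  obtain ⟨n, ⟨en⟩⟩ := Finite.exists_equiv_fin Q.P
  let key : Q.P → Fin p ×ₗ Fin n := fun q => toLex (Q.π q, en q)
  have hkey : Function.Injective key := fun x y h => by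
    have h' := congrArg (fun z => (ofLex z).2) h
    exact en.injective h'
  refine ⟨Q.P, LinearOrder.lift' key hkey, Q.R, Q.fin, Q.symm, fun x h => Q.ne _ _ h rfl,
    fun χ => ?_⟩
  obtain ⟨φ, hφ, hcol⟩ := hQ χ
  have hcol' : ∀ ε : T → Fin p, ∃ col, StrictMono ε →
      ∀ u : P0.Copy adjT ε, χ (φ ∘ u.1) = col := fun ε => by
    by_cases h : StrictMono ε
    · obtain ⟨col, h'⟩ := hcol ε (List.mem_map.2 ⟨⟨ε, h⟩, by simp, rfl⟩)
      exact ⟨col, fun _ => h'⟩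
    · exact ⟨Classical.arbitrary κ, fun h' => absurd h' h⟩
  choose c hc using hcol'
  obtain ⟨m, hm, col, hmc⟩ := hp c
  refine ⟨fun x => φ (⟨m, hm⟩, x), ?_, ?_, col, fun u hu hadj => ?_⟩
  · intro x y hxy
    show key _ < key _
    rw [Prod.Lex.lt_iff]
    left
    simp only [key, ofLex_toLex, hφ.proj]
    exact hm hxy
  · intro x y
    rw [hφ.rel]
    simp [P0]
  · rw [← hmc u hu]
    exact hc (m ∘ u) (hm.comp hu) ⟨fun t => (⟨m, hm⟩, u t), fun t => rfl, fun s t => by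
      simp [P0, hadj]⟩

end SRAux

namespace SRAux

open SRPaper

/-! ### Embedding form of the Ramsey property, products -/

theorem emb_ramsey {L : Language} {K : Set (Bundled.{0} L.Structure)}
    (hK : RamseyClass L K)
    (hrig : ∀ A C : Bundled.{0} L.Structure, A ∈ K → C ∈ K → ∀ f g : A ↪[L] C,
      Set.range f = Set.range g → (f : A → C) = g)
    (κ : Type) [Finite κ] [Nonempty κ] (A D : Bundled.{0} L.Structure) (hA : A ∈ K) (hD : D ∈ K) :
    ∃ C : Bundled.{0} L.Structure, C ∈ K ∧ ∀ c : (A → C) → κ, ∃ f : D ↪[L] C, ∃ col,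
      ∀ g : A ↪[L] D, c (f ∘ g) = col := by
  classical
  obtain ⟨k, ⟨ek⟩⟩ := Finite.exists_equiv_fin κ
  have hk : 1 ≤ k := by
    have := ek (Classical.arbitrary κ)
    exact Nat.succ_le_of_lt (Nat.lt_of_le_of_lt (Nat.zero_le _) this.2)
  obtain ⟨C, hC, h⟩ := hK A D hA hD k hk
  refine ⟨C, hC, fun c => ?_⟩
  let c' : L.Substructure C → Fin k := fun S =>
    if hS : ∃ v : A ↪[L] C, Set.range v = (S : Set C) then ek (c hS.choose)
    else ek (Classical.arbitrary κ)
  obtain ⟨B', ⟨e⟩, hB⟩ := h c'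
  let f : D ↪[L] C := B'.subtype.comp e.toEmbedding
  have key : ∀ v : A ↪[L] C, c' v.toHom.range = ek (c v) := fun v => by
    have hS : ∃ w : A ↪[L] C, Set.range w = (v.toHom.range : Set C) := ⟨v, rfl⟩
    simp only [c', dif_pos hS]
    rw [hrig A C hA hC hS.choose v]
    exact hS.choose_spec
  have hle : ∀ g : A ↪[L] D, (f.comp g).toHom.range ≤ B' := by
    rintro g x ⟨a, rfl⟩
    exact (e (g a)).2
  refine ⟨f, ?_⟩
  by_cases hg : Nonempty (A ↪[L] D)
  · obtain ⟨g0⟩ := hg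
    refine ⟨c (f ∘ g0), fun g => ek.injective ?_⟩
    have := hB _ _ (hle g) (hle g0) ⟨(f.comp g).equivRange⟩ ⟨(f.comp g0).equivRange⟩
    rw [key, key] at this
    exact this
  · exact ⟨Classical.arbitrary κ, fun g => absurd ⟨g⟩ hg⟩

theorem emb_ramsey_multi {L : Language} {K : Set (Bundled.{0} L.Structure)}
    (hK : RamseyClass L K)
    (hrig : ∀ A C : Bundled.{0} L.Structure, A ∈ K → C ∈ K → ∀ f g : A ↪[L] C,
      Set.range f = Set.range g → (f : A → C) = g)
    (κ : Type) [Finite κ] [Nonempty κ] (T : Type) [Finite T] (A : T → Bundled.{0} L.Structure)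
    (hA : ∀ t, A t ∈ K) (D : Bundled.{0} L.Structure) (hD : D ∈ K) :
    ∃ C : Bundled.{0} L.Structure, C ∈ K ∧ ∀ c : ∀ t, (A t → C) → κ, ∃ f : D ↪[L] C,
      ∀ t, ∃ col, ∀ g : A t ↪[L] D, c t (f ∘ g) = col := by
  classical
  have := Fintype.ofFinite T
  suffices H : ∀ U : Finset T, ∃ C : Bundled.{0} L.Structure, C ∈ K ∧
      ∀ c : ∀ t, (A t → C) → κ, ∃ f : D ↪[L] C,
      ∀ t ∈ U, ∃ col, ∀ g : A t ↪[L] D, c t (f ∘ g) = col by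
    obtain ⟨C, hC, h⟩ := H Finset.univ
    refine ⟨C, hC, fun c => ?_⟩
    obtain ⟨f, hf⟩ := h c
    exact ⟨f, fun t => hf t (Finset.mem_univ t)⟩
  intro U
  induction U using Finset.induction_on with
  | empty => exact ⟨D, hD, fun c => ⟨Embedding.refl L D, by simp⟩⟩
  | insert t U _ ih =>
    obtain ⟨C, hC, h⟩ := ih
    obtain ⟨C', hC', h'⟩ := emb_ramsey hK hrig κ (A t) C (hA t) hC
    refine ⟨C', hC', fun c => ?_⟩
    obtain ⟨f', col', hf'⟩ := h' (c t)
    obtain ⟨f, hf⟩ := h (fun s v => c s (f' ∘ v))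
    refine ⟨f'.comp f, fun s hs => ?_⟩
    rcases Finset.mem_insert.1 hs with rfl | hs
    · exact ⟨col', fun g => hf' (f.comp g)⟩
    · exact hf s hs

section Fiber

open Classical in
/-- The map `A → Σ i, M i` given by a map `g` of indices and fibrewise data `x`; indices outside
of `H` are sent to the junk value `z`. -/
noncomputable def mkMap {I A T D : Type} {M : I → Type} (τ : A → T) (z : Σ i, M i) (H : Finset I)
    (g : T → I) (δ : ∀ i, D → M i) (x : A → D) : A → Σ i, M i :=
  fun a => if g (τ a) ∈ H then ⟨g (τ a), δ _ (x a)⟩ else z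

/-- `x` is fibrewise an embedding. -/
def FibEmb (L : Language) {A T D : Type} (τ : A → T) [∀ t, L.Structure {a // τ a = t}]
    [L.Structure D] (x : A → D) : Prop :=
  ∀ t, ∃ v : {a // τ a = t} ↪[L] D, ∀ a, v a = x a.1

theorem fiber_ramsey {L : Language} {K : Set (Bundled.{0} L.Structure)}
    (hK : RamseyClass L K)
    (hrig : ∀ A C : Bundled.{0} L.Structure, A ∈ K → C ∈ K → ∀ f g : A ↪[L] C,
      Set.range f = Set.range g → (f : A → C) = g)
    {I : Type} (M : I → Type) [∀ i, L.Structure (M i)]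
    (hKM : ∀ C ∈ K, ∀ i, Finite C ∧ Nonempty (C ↪[L] M i))
    {A T : Type} [Finite A] [Finite T] (τ : A → T) [∀ t, L.Structure {a // τ a = t}]
    (hA : ∀ t, (⟨{a // τ a = t}, inferInstance⟩ : Bundled.{0} L.Structure) ∈ K)
    (D : Bundled.{0} L.Structure) (hD : D ∈ K) (z : Σ i, M i) (H : Finset I) :
    ∀ (κ : Type) [Finite κ] [Nonempty κ], ∃ S : ∀ i, Set (M i), (∀ i, (S i).Finite) ∧
      ∀ c : (A → Σ i, M i) → κ, ∃ δ : ∀ i, D ↪[L] M i, (∀ i, Set.range (δ i) ⊆ S i) ∧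
        ∀ g : T → I, (∀ s t, g s = g t → g s ∈ H → s = t) → ∀ x y : A → D,
          FibEmb L τ x → FibEmb L τ y →
          c (mkMap τ z H g (fun i => δ i) x) = c (mkMap τ z H g (fun i => δ i) y) := by
  classical
  induction H using Finset.induction_on with
  | empty =>
    intro κ _ _
    have h := fun i => (hKM D hD i).2.some
    have := (hKM D hD z.1).1
    refine ⟨fun i => Set.range (h i), fun i => Set.finite_range _, fun c => ⟨h, fun i => subset_rfl, ?_⟩⟩
    intro g _ x y _ _
    congr 1
  | insert h H hH ih =>
    intro κ _ _
    obtain ⟨S, hS, hc⟩ := ih (Option T → κ)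
    let Z : Set (Σ i, M i) := insert z (⋃ i ∈ H, Sigma.mk i '' S i)
    have hZ : Z.Finite := by
      apply Set.Finite.insert
      exact Set.Finite.biUnion H.finite_toSet (fun i _ => (hS i).image _)
    have : Finite Z := hZ
    let W := A → Z
    obtain ⟨C, hC, hCc⟩ := emb_ramsey_multi hK hrig (W → κ) T _ hA D hD
    obtain ⟨hCfin, ⟨ψ⟩⟩ := hKM C hC h
    refine ⟨Function.update S h (Set.range ψ), fun i => ?_, fun c => ?_⟩
    · by_cases hi : i = h
      · subst hi; rw [Function.update_self]; exact Set.finite_range _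
      · rw [Function.update_of_ne hi]; exact hS i
    -- combine values over `t` with the rest
    let comb : (t : T) → ({a // τ a = t} → C) → (A → Σ i, M i) → A → Σ i, M i :=
      fun t y w a => if e : τ a = t then ⟨h, ψ (y ⟨a, e⟩)⟩ else w a
    obtain ⟨f, hf⟩ := hCc (fun t y (w : W) => c (comb t y (fun a => (w a).1)))
    by_cases hx0 : ∃ x0 : A → D, FibEmb L τ x0
    swap
    · have e := fun i => (hKM D hD i).2.some
      obtain ⟨δ, hδ, -⟩ := hc (fun _ _ => Classical.arbitrary κ)
      refine ⟨Function.update δ h (ψ.comp f), fun i => ?_, fun g _ x y hx => absurd ⟨x, hx⟩ hx0⟩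
      by_cases hi : i = h
      · subst hi; simp only [Function.update_self]
        rintro _ ⟨b, rfl⟩; exact ⟨f b, rfl⟩
      · simp only [Function.update_of_ne hi]; exact hδ i
    obtain ⟨x0, hx0⟩ := hx0
    obtain ⟨δ, hδ, hδc⟩ := hc (fun w o => o.elim (c w) (fun t => c (comb t (fun a => f (x0 a.1)) w)))
    refine ⟨Function.update δ h (ψ.comp f), fun i => ?_, fun g hg x y hx hy => ?_⟩
    · by_cases hi : i = h
      · subst hi; simp only [Function.update_self]
        rintro _ ⟨b, rfl⟩; exact ⟨f b, rfl⟩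
      · simp only [Function.update_of_ne hi]; exact hδ i
    set δ' := Function.update δ h (ψ.comp f) with hδ'
    have hg' : ∀ s t, g s = g t → g s ∈ H → s = t := fun s t h1 h2 =>
      hg s t h1 (Finset.mem_insert_of_mem h2)
    have hδh : ∀ d, δ' h d = ψ (f d) := fun d => by rw [hδ', Function.update_self]; rfl
    have hδi : ∀ i, i ≠ h → δ' i = δ i := fun i hi => by rw [hδ', Function.update_of_ne hi]
    have off : ∀ x a, g (τ a) ≠ h → mkMap τ z (insert h H) g (fun i => δ' i) x a =
        mkMap τ z H g (fun i => δ i) x a := fun x a ha => by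
      simp only [mkMap, Finset.mem_insert, ha, false_or, hδi _ ha]
    by_cases ht : ∃ t, g t = h
    · obtain ⟨t, ht⟩ := ht
      have on : ∀ x, mkMap τ z (insert h H) g (fun i => δ' i) x =
          comb t (fun a => f (x a.1)) (mkMap τ z H g (fun i => δ i) x) := fun x => by
        funext a
        by_cases ha : τ a = t
        · have hga : g (τ a) = h := by rw [ha, ht]
          simp only [comb, dif_pos ha, mkMap]
          rw [if_pos (by rw [hga]; exact Finset.mem_insert_self _ _)]
          rw [hga, hδh]
        · simp only [comb, dif_neg ha]
          apply off
          intro hga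
          exact ha (hg _ _ (hga.trans ht.symm) (by rw [hga]; exact Finset.mem_insert_self _ _))
      have main : ∀ x, FibEmb L τ x → c (mkMap τ z (insert h H) g (fun i => δ' i) x) =
          c (comb t (fun a => f (x0 a.1)) (mkMap τ z H g (fun i => δ i) x)) := fun x hx => by
        rw [on x]
        obtain ⟨col, hcol⟩ := hf t
        obtain ⟨v, hv⟩ := hx t
        obtain ⟨v0, hv0⟩ := hx0 t
        have h1 := (hcol v).trans (hcol v0).symm
        have hw : ∀ a, mkMap τ z H g (fun i => δ i) x a ∈ Z := fun a => by
          unfold mkMap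
          split_ifs with hm
          · refine Set.mem_insert_of_mem _ ?_
            simp only [Set.mem_iUnion]
            exact ⟨_, hm, _, hδ _ ⟨x a, rfl⟩, rfl⟩
          · exact Set.mem_insert _ _
        have h2 := congrFun h1 (fun a => ⟨_, hw a⟩)
        have e1 : ((f : D → C) ∘ v) = fun a => f (x a.1) := funext fun a => by
          rw [Function.comp, hv]
        have e2 : ((f : D → C) ∘ v0) = fun a => f (x0 a.1) := funext fun a => by
          rw [Function.comp, hv0]
        simp only [e1, e2] at h2
        exact h2
      rw [main x hx, main y hy]
      exact congrFun (hδc g hg' x y hx hy) (some t)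
    · have e : ∀ x, mkMap τ z (insert h H) g (fun i => δ' i) x =
          mkMap τ z H g (fun i => δ i) x := fun x =>
        funext fun a => off x a (fun hga => ht ⟨_, hga⟩)
      rw [e, e]
      exact congrFun (hδc g hg' x y hx hy) none

end Fiber

end SRAux

namespace SRAux

open SRPaper

/-! ### Model-theoretic facts -/

theorem emb_le_iff {L1 : Language} {A N : Type} [(L1.sum Language.order).Structure A]
    [L1.Structure N] [LinearOrder N] (e : A ↪[L1.sum Language.order] N) (a b : A) :
    e a ≤ e b ↔ RelMap (L := L1.sum Language.order) (Sum.inr orderRel.le) ![a, b] :=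
  e.map_rel (Sum.inr orderRel.le : (L1.sum Language.order).Relations 2) ![a, b]

theorem rigid {L1 : Language} [L1.IsRelational] {N : Type} [L1.Structure N] [LinearOrder N]
    (A C : Bundled.{0} (L1.sum Language.order).Structure)
    (hA : A ∈ (L1.sum Language.order).age N) (hC : C ∈ (L1.sum Language.order).age N)
    (f g : A ↪[L1.sum Language.order] C) (hfg : Set.range f = Set.range g) :
    (f : A → C) = g := by
  obtain ⟨hfin, ⟨φ⟩⟩ := hA
  obtain ⟨-, ⟨ψ⟩⟩ := hC
  have hfin' : Finite A := hfin.finite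
  letI : LinearOrder A := LinearOrder.lift' φ φ.injective
  have mono : ∀ h : A ↪[L1.sum Language.order] C, StrictMono (ψ ∘ h) := fun h => by
    apply strictMono_of_le_iff_le
    intro x y
    exact (emb_le_iff φ x y).trans (emb_le_iff (ψ.comp h) x y).symm
  have := (StrictMono.range_inj (mono f) (mono g)).1 (by rw [Set.range_comp, Set.range_comp, hfg])
  exact ψ.injective.comp_left this

/-- Adjacency in a graph structure. -/
def adjI {I : Type} [langGr.Structure I] (x y : I) : Prop :=
  RelMap (L := langGr) GrSymb.adj ![x, y]

theorem relational_OG : langOG.IsRelational := fun _ => inferInstanceAs (IsEmpty (Empty ⊕ Empty))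

theorem graph_facts (I : Type) [langGr.Structure I] [LinearOrder I] [Countable I]
    (hI : IsRandomOrderedGraph I) (x y : I) :
    (¬ adjI x x) ∧ (adjI x y → adjI y x) := by
  letI : langOG.Structure I := inferInstanceAs ((langGr.sum Language.order).Structure I)
  haveI := relational_OG
  have hage : langOG.age I =
    {N : CategoryTheory.Bundled langOG.Structure | Finite N ∧ IsOrderedGraph N} := hI.age
  let N := Substructure.closure langOG ({x, y} : Set I)
  have hN : (Bundled.of N : Bundled langOG.Structure) ∈ langOG.age I :=
    ⟨(Substructure.fg_iff_structure_fg _).1 (Substructure.fg_closure (by simp)), ⟨N.subtype⟩⟩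
  rw [hage] at hN
  obtain ⟨h1, h2, -⟩ := hN.2
  have hx : x ∈ N := Substructure.subset_closure (by simp)
  have hy : y ∈ N := Substructure.subset_closure (by simp)
  have key : ∀ a b : N, RelMap (L := langOG) (Sum.inl GrSymb.adj) ![a, b] ↔ adjI a.1 b.1 := by
    intro a b
    have := N.subtype.map_rel (Sum.inl GrSymb.adj : langOG.Relations 2) ![a, b]
    rw [← this]
    show RelMap (L := langGr) GrSymb.adj _ ↔ _
    unfold adjI
    rw [show (N.subtype ∘ ![a, b] : Fin 2 → I) = ![a.1, b.1] by
      funext k; fin_cases k <;> rfl]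
  refine ⟨fun h => h1 ⟨x, hx⟩ ((key _ _).2 h), fun h => ?_⟩
  exact (key ⟨y, hy⟩ ⟨x, hx⟩).1 (h2 ⟨x, hx⟩ ⟨y, hy⟩ ((key _ _).2 h))

theorem graph_universal (I : Type) [langGr.Structure I] [LinearOrder I] [Countable I]
    (hI : IsRandomOrderedGraph I) (P : Type) [Finite P] [LinearOrder P] (R : P → P → Prop)
    (hsymm : ∀ x y, R x y → R y x) (hirr : ∀ x, ¬ R x x) :
    ∃ η : P → I, StrictMono η ∧ ∀ x y, adjI (η x) (η y) ↔ R x y := by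
  letI : langOG.Structure I := inferInstanceAs ((langGr.sum Language.order).Structure I)
  haveI := relational_OG
  have hage : langOG.age I =
    {N : CategoryTheory.Bundled langOG.Structure | Finite N ∧ IsOrderedGraph N} := hI.age
  letI gP : langGr.Structure P :=
    { funMap := fun f _ => Empty.elim f
      RelMap := fun {n} r v =>
        match n, r, v with
        | _, GrSymb.adj, v => R (v 0) (v 1) }
  letI oP : langOG.Structure P := inferInstanceAs ((langGr.sum Language.order).Structure P)
  have hP : (Bundled.of P : Bundled langOG.Structure) ∈ langOG.age I := by
    rw [hage]
    refine ⟨‹Finite P›, fun x => hirr x, fun x y => hsymm x y, ?_⟩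
    show IsLinearOrder P (fun a b => a ≤ b)
    infer_instance
  obtain ⟨-, ⟨η⟩⟩ := hP
  refine ⟨η, ?_, fun x y => ?_⟩
  · apply strictMono_of_le_iff_le
    intro x y
    exact (η.map_rel (Sum.inr orderRel.le : langOG.Relations 2) ![x, y]).symm
  · have := η.map_rel (Sum.inl GrSymb.adj : langOG.Relations 2) ![x, y]
    have e : ((η : P → I) ∘ ![x, y] : Fin 2 → I) = ![η x, η y] := by
      funext k; fin_cases k <;> rfl
    erw [e] at this
    exact this

section SD

variable {L1 : Language} [L1.IsRelational]

/-- Symbols of the language of the semi-direct product. -/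
def sL {n : ℕ} (r : (L1.sum Language.order).Relations n) : (langSD L1 langGr).Relations n :=
  Sum.inl (Sum.inl r)

def sE : (langSD L1 langGr).Relations 2 := Sum.inl (Sum.inr EqSymb.E)

def sAdj : (langSD L1 langGr).Relations 2 := Sum.inr GrSymb.adj

instance relational_SD : (langSD L1 langGr).IsRelational := fun n =>
  inferInstanceAs (IsEmpty (((L1.Functions n ⊕ Empty) ⊕ Empty) ⊕ Empty))

/-- The reduct to the language of the fibers on a subset. -/
@[reducible] def fibStr {A : Type} [(langSD L1 langGr).Structure A] (p : A → Prop) :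
    (L1.sum Language.order).Structure {a // p a} where
  funMap := fun f _ => isEmptyElim f
  RelMap := fun r v => RelMap (sL r) (fun k => (v k).1)

variable {I : Type} [langGr.Structure I] [LinearOrder I] {M : I → Type}
    [∀ i, L1.Structure (M i)] [∀ i, LinearOrder (M i)]

theorem relX_L {n : ℕ} (r : L1.Relations n) (v : Fin n → Σₗ i, M i) :
    RelMap (sL (Sum.inl r)) v ↔
      ∃ (i : I) (w : Fin n → M i), (∀ k, v k = toLex ⟨i, w k⟩) ∧ RelMap r w := Iff.rfl

theorem relX_le (v : Fin 2 → Σₗ i, M i) :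
    RelMap (sL (L1 := L1) (Sum.inr orderRel.le)) v ↔ v 0 ≤ v 1 := Iff.rfl

theorem relX_E (v : Fin 2 → Σₗ i, M i) :
    RelMap (sE (L1 := L1)) v ↔ (ofLex (v 0)).1 = (ofLex (v 1)).1 := Iff.rfl

theorem relX_adj (v : Fin 2 → Σₗ i, M i) :
    RelMap (sAdj (L1 := L1)) v ↔ adjI (ofLex (v 0)).1 (ofLex (v 1)).1 := by
  show RelMap (L := langGr) GrSymb.adj (fun k => (ofLex (v k)).1) ↔ _
  unfold adjI
  rw [show (fun k => (ofLex (v k)).1) = ![(ofLex (v 0)).1, (ofLex (v 1)).1] by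
      funext k; fin_cases k <;> rfl]

/-- On a fiber, the relations of the semi-direct product are those of the fiber. -/
theorem relX_fiber (hnull : ∀ (r : L1.Relations 0) (i j : I) (w : Fin 0 → M i) (w' : Fin 0 → M j),
      RelMap r w → RelMap r w') (i : I) {n : ℕ} (r : (L1.sum Language.order).Relations n)
    (w : Fin n → M i) :
    RelMap (sL r) (fun k => (toLex ⟨i, w k⟩ : Σₗ i, M i)) ↔ RelMap r w := by
  rcases r with r | r
  · rw [relX_L]
    constructor
    · rintro ⟨j, w', h, hr⟩
      rcases n with _ | n
      · exact hnull r j i w' w hr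
      · have hj : i = j := congrArg (fun q : Σₗ i, M i => (ofLex q).1) (h 0)
        subst hj
        have : w = w' := funext fun k => by
          have := toLex.injective (h k)
          simpa using this
        rw [this]; exact hr
    · intro h
      exact ⟨i, w, fun _ => rfl, h⟩
  · cases r
    rw [relX_le]
    show _ ↔ w 0 ≤ w 1
    rw [Sigma.Lex.le_def]
    constructor
    · rintro (h | ⟨_, h⟩)
      · exact absurd h (lt_irrefl i)
      · exact h
    · intro h
      exact Or.inr ⟨rfl, h⟩

theorem fib_embed (hnull : ∀ (r : L1.Relations 0) (i j : I) (w : Fin 0 → M i) (w' : Fin 0 → M j),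
      RelMap r w → RelMap r w') {A : Type} [(langSD L1 langGr).Structure A]
    (α : A ↪[langSD L1 langGr] Σₗ i, M i) (p : A → Prop) (i : I)
    (hp : ∀ a, p a → (ofLex (α a)).1 = i) :
    letI := fibStr (L1 := L1) p
    Nonempty ({a // p a} ↪[L1.sum Language.order] M i) := by
  letI := fibStr (L1 := L1) p
  have h : ∀ a : {a // p a}, ∃ m : M i, α a = toLex ⟨i, m⟩ := fun a => by
    have := hp a.1 a.2
    subst this
    exact ⟨(ofLex (α a)).2, rfl⟩
  choose m hm using h
  refine ⟨⟨⟨m, fun a b hab => ?_⟩, fun f => isEmptyElim f, fun {n} r v => ?_⟩⟩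
  · apply Subtype.ext
    apply α.injective
    rw [hm, hm, hab]
  · have h1 := α.map_rel (sL r) (fun k => (v k).1)
    have h2 : (α ∘ fun k => (v k).1) = fun k => (toLex ⟨i, m (v k)⟩ : Σₗ i, M i) :=
      funext fun k => hm _
    rw [h2, relX_fiber hnull] at h1
    exact h1

/-- The index of a point. -/
def idx {A : Type} (α : A → Σₗ i, M i) : A → {i : I // ∃ a, (ofLex (α a)).1 = i} :=
  fun a => ⟨(ofLex (α a)).1, a, rfl⟩

theorem build_emb {B : Type} [(langSD L1 langGr).Structure B]
    (hnull : ∀ (r : L1.Relations 0) (i j : I) (w : Fin 0 → M i) (w' : Fin 0 → M j),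
      RelMap r w → RelMap r w')
    (β : B ↪[langSD L1 langGr] Σₗ i, M i) (D : Bundled.{0} (L1.sum Language.order).Structure)
    (j : B → D)
    (hj : letI := fun t => fibStr (L1 := L1) (fun b : B => idx β b = t)
      FibEmb (L1.sum Language.order) (idx β) j)
    (f : {i : I // ∃ a, (ofLex (β a)).1 = i} → I) (hf : StrictMono f)
    (hadj : ∀ s t, adjI (f s) (f t) ↔ adjI s.1 t.1)
    (δ : ∀ i, D ↪[L1.sum Language.order] M i) :
    ∃ F : B ↪[langSD L1 langGr] Σₗ i, M i,
      ∀ b, F b = toLex ⟨f (idx β b), δ _ (j b)⟩ := by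
  letI := fun t => fibStr (L1 := L1) (fun b : B => idx β b = t)
  let F : B → Σₗ i, M i := fun b => toLex ⟨f (idx β b), δ _ (j b)⟩
  have hidx : ∀ b b', idx β b = idx β b' ↔ (ofLex (β b)).1 = (ofLex (β b')).1 := fun b b' =>
    Subtype.ext_iff
  -- relations on one fibre
  have hfib : ∀ {n : ℕ} (r : (L1.sum Language.order).Relations n) (v : Fin n → B) t,
      (∀ k, idx β (v k) = t) → (RelMap (sL r) (F ∘ v) ↔ RelMap (sL r) v) := by
    intro n r v t ht
    obtain ⟨e, he⟩ := hj t
    have h1 : F ∘ v = fun k => (toLex ⟨f t, δ (f t) (j (v k))⟩ : Σₗ i, M i) := funext fun k => by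
      show (toLex ⟨f (idx β (v k)), δ _ (j (v k))⟩ : Σₗ i, M i) = _
      rw [ht k]
    rw [h1, relX_fiber hnull]
    have h2 := (δ (f t)).map_rel r (fun k => j (v k))
    have h3 := e.map_rel r (fun k => ⟨v k, ht k⟩)
    have h4 : (e ∘ fun k => (⟨v k, ht k⟩ : {b // idx β b = t})) = fun k => j (v k) :=
      funext fun k => he _
    rw [h4] at h3
    exact h2.trans h3
  have hinj : Function.Injective F := by
    intro b b' h
    have h1 : f (idx β b) = f (idx β b') := congrArg (fun q : Σₗ i, M i => (ofLex q).1) h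
    have h2 := hf.injective h1
    obtain ⟨e, he⟩ := hj (idx β b')
    have h3 : j b = j b' := by
      simp only [F] at h
      rw [h2] at h
      have := toLex.injective h
      simp only [Sigma.mk.injEq, heq_eq_eq, true_and] at this
      exact (δ _).injective this
    have := e.injective (((he ⟨b, h2⟩).trans h3).trans (he ⟨b', rfl⟩).symm)
    exact congrArg Subtype.val this
  have hle : ∀ b b', F b ≤ F b' ↔ β b ≤ β b' := by
    intro b b'
    by_cases hbb : idx β b = idx β b'
    · have h1 := hfib (Sum.inr orderRel.le) ![b, b'] (idx β b') (by
        intro k; fin_cases k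
        · exact hbb
        · rfl)
      have h2 := β.map_rel (sL (L1 := L1) (Sum.inr orderRel.le)) ![b, b']
      exact h1.trans h2.symm
    · have hne : (ofLex (β b)).1 ≠ (ofLex (β b')).1 := fun h => hbb ((hidx _ _).2 h)
      have hne' : f (idx β b) ≠ f (idx β b') := fun h => hbb (hf.injective h)
      have e1 : F b ≤ F b' ↔ f (idx β b) < f (idx β b') := by
        rw [Sigma.Lex.le_def]
        constructor
        · rintro (h | ⟨h, -⟩)
          · exact h
          · exact absurd h hne'
        · exact Or.inl
      have e2 : β b ≤ β b' ↔ (ofLex (β b)).1 < (ofLex (β b')).1 := by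
        rw [Sigma.Lex.le_def]
        constructor
        · rintro (h | ⟨h, -⟩)
          · exact h
          · exact absurd h hne
        · exact Or.inl
      rw [e1, e2, hf.lt_iff_lt]
      rfl
  refine ⟨⟨⟨F, hinj⟩, fun f => isEmptyElim f, fun {n} r v => ?_⟩, fun b => rfl⟩
  show RelMap r (F ∘ v) ↔ RelMap r v
  rcases r with ((r | r) | r) | r
  · show RelMap (sL (Sum.inl r)) (F ∘ v) ↔ RelMap (sL (Sum.inl r)) v
    rcases n with _ | n
    · rw [← β.map_rel, Subsingleton.elim (F ∘ v) (β ∘ v)]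
    · constructor
      · intro h
        obtain ⟨i, w, hw, -⟩ := (relX_L _ _).1 h
        refine (hfib _ v (idx β (v 0)) (fun k => ?_)).1 h
        apply hf.injective
        have hk : f (idx β (v k)) = i := congrArg (fun q : Σₗ i, M i => (ofLex q).1) (hw k)
        have h0 : f (idx β (v 0)) = i := congrArg (fun q : Σₗ i, M i => (ofLex q).1) (hw 0)
        rw [hk, h0]
      · intro h
        have h' := (β.map_rel _ _).2 h
        obtain ⟨i, w, hw, -⟩ := (relX_L _ _).1 h'
        refine (hfib _ v (idx β (v 0)) (fun k => ?_)).2 h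
        rw [hidx]
        have hk : (ofLex (β (v k))).1 = i := congrArg (fun q : Σₗ i, M i => (ofLex q).1) (hw k)
        have h0 : (ofLex (β (v 0))).1 = i := congrArg (fun q : Σₗ i, M i => (ofLex q).1) (hw 0)
        rw [hk, h0]
  · cases r
    exact (hle (v 0) (v 1)).trans (β.map_rel (sL (L1 := L1) (Sum.inr orderRel.le)) v)
  · cases r
    refine Iff.trans ?_ (β.map_rel (sE (L1 := L1)) v)
    show f (idx β (v 0)) = f (idx β (v 1)) ↔ (ofLex (β (v 0))).1 = (ofLex (β (v 1))).1
    rw [hf.injective.eq_iff, hidx]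
  · cases r
    refine Iff.trans ?_ (β.map_rel (sAdj (L1 := L1)) v)
    refine (relX_adj (L1 := L1) (F ∘ v)).trans (Iff.trans ?_ (relX_adj (L1 := L1) (β ∘ v)).symm)
    exact hadj (idx β (v 0)) (idx β (v 1))

theorem induced_map {A B : Type} [(langSD L1 langGr).Structure A]
    [(langSD L1 langGr).Structure B]
    (α : A ↪[langSD L1 langGr] Σₗ i, M i) (β : B ↪[langSD L1 langGr] Σₗ i, M i)
    (v : A ↪[langSD L1 langGr] B) :
    ∃ u : {i : I // ∃ a, (ofLex (α a)).1 = i} → {i : I // ∃ b, (ofLex (β b)).1 = i},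
      StrictMono u ∧ (∀ s t, adjI (u s).1 (u t).1 ↔ adjI s.1 t.1) ∧
      ∀ a, idx β (v a) = u (idx α a) := by
  have hE : ∀ a a', (ofLex (β (v a))).1 = (ofLex (β (v a'))).1 ↔
      (ofLex (α a)).1 = (ofLex (α a')).1 := fun a a' =>
    ((β.comp v).map_rel (sE (L1 := L1)) ![a, a']).trans
      (α.map_rel (sE (L1 := L1)) ![a, a']).symm
  have hle : ∀ a a', β (v a) ≤ β (v a') ↔ α a ≤ α a' := fun a a' =>
    ((β.comp v).map_rel (sL (L1 := L1) (Sum.inr orderRel.le)) ![a, a']).trans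
      (α.map_rel (sL (L1 := L1) (Sum.inr orderRel.le)) ![a, a']).symm
  have hadj : ∀ a a', adjI (ofLex (β (v a))).1 (ofLex (β (v a'))).1 ↔
      adjI (ofLex (α a)).1 (ofLex (α a')).1 := fun a a' =>
    (relX_adj (L1 := L1) (β.comp v ∘ ![a, a'])).symm.trans
      (((β.comp v).map_rel (sAdj (L1 := L1)) ![a, a']).trans
      ((α.map_rel (sAdj (L1 := L1)) ![a, a']).symm.trans (relX_adj (L1 := L1) (α ∘ ![a, a']))))
  let u : {i : I // ∃ a, (ofLex (α a)).1 = i} → {i : I // ∃ b, (ofLex (β b)).1 = i} :=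
    fun t => idx β (v t.2.choose)
  have hu : ∀ a, idx β (v a) = u (idx α a) := fun a => by
    apply Subtype.ext
    exact (hE _ _).2 (idx α a).2.choose_spec.symm
  refine ⟨u, ?_, ?_, hu⟩
  · rintro ⟨s, a, rfl⟩ ⟨t, b, rfl⟩ hst
    change (ofLex (α a)).1 < (ofLex (α b)).1 at hst
    have h1 := (hu a).symm
    have h2 := (hu b).symm
    change u ⟨_, a, rfl⟩ = _ at h1
    change u ⟨_, b, rfl⟩ = _ at h2
    rw [h1, h2]
    have h3 : β (v a) ≤ β (v b) := (hle a b).2 (by rw [Sigma.Lex.le_def]; exact Or.inl hst)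
    rw [Sigma.Lex.le_def] at h3
    rcases h3 with h3 | ⟨h3, -⟩
    · exact h3
    · exact absurd ((hE _ _).1 h3) hst.ne
  · rintro ⟨s, a, rfl⟩ ⟨t, b, rfl⟩
    have h1 := (hu a).symm
    have h2 := (hu b).symm
    change u ⟨_, a, rfl⟩ = _ at h1
    change u ⟨_, b, rfl⟩ = _ at h2
    rw [h1, h2]
    exact hadj a b

theorem fibEmb_comp {A B : Type} [(langSD L1 langGr).Structure A]
    [(langSD L1 langGr).Structure B] {T T' : Type} (τ : A → T) (τ' : B → T')
    (v : A ↪[langSD L1 langGr] B) (u : T → T') (hu : ∀ a, τ' (v a) = u (τ a))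
    (D : Type) [(L1.sum Language.order).Structure D] (j : B → D)
    (hj : letI := fun t => fibStr (L1 := L1) (fun b : B => τ' b = t)
      FibEmb (L1.sum Language.order) τ' j) :
    letI := fun t => fibStr (L1 := L1) (fun a : A => τ a = t)
    FibEmb (L1.sum Language.order) τ (j ∘ v) := by
  letI := fun t => fibStr (L1 := L1) (fun a : A => τ a = t)
  letI := fun t => fibStr (L1 := L1) (fun b : B => τ' b = t)
  intro t
  obtain ⟨e, he⟩ := hj (u t)
  let w : {a // τ a = t} ↪[L1.sum Language.order] {b // τ' b = u t} :=
    { toFun := fun a => ⟨v a.1, by rw [hu, a.2]⟩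
      inj' := fun a b h => Subtype.ext (v.injective (congrArg Subtype.val h))
      map_fun' := fun f => isEmptyElim f
      map_rel' := fun r x => v.map_rel (sL r) (fun k => (x k).1) }
  exact ⟨e.comp w, fun a => he _⟩

end SD

end SRAux

namespace SRAux

open SRPaper

theorem closure_mem_age {L : Language} {N : Type} [L.Structure N] (S : Set N) (hS : S.Finite) :
    (Bundled.of (Substructure.closure L S) : Bundled.{0} L.Structure) ∈ L.age N :=
  ⟨(Substructure.fg_iff_structure_fg _).1 (Substructure.fg_closure hS),
    ⟨(Substructure.closure L S).subtype⟩⟩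

section Main

variable {L1 : Language} [L1.IsRelational]
variable {I : Type} [langGr.Structure I] [LinearOrder I] {M : I → Type}
    [∀ i, L1.Structure (M i)] [∀ i, LinearOrder (M i)]

theorem nullary_agree (K : Set (Bundled.{0} (L1.sum Language.order).Structure))
    (hK : ∀ i, (L1.sum Language.order).age (M i) = K)
    (r : L1.Relations 0) (i j : I) (w : Fin 0 → M i) (w' : Fin 0 → M j)
    (h : RelMap r w) : RelMap r w' := by
  let N := Substructure.closure (L1.sum Language.order) (∅ : Set (M i))
  have hN := closure_mem_age (L := L1.sum Language.order) (∅ : Set (M i)) Set.finite_empty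
  rw [hK i, ← hK j] at hN
  obtain ⟨-, ⟨ψ⟩⟩ := hN
  have h1 := N.subtype.map_rel (Sum.inl r : (L1.sum Language.order).Relations 0) Fin.elim0
  have h2 := ψ.map_rel (Sum.inl r : (L1.sum Language.order).Relations 0) Fin.elim0
  rw [Subsingleton.elim (N.subtype ∘ Fin.elim0) w] at h1
  rw [Subsingleton.elim (ψ ∘ Fin.elim0) w'] at h2
  exact h2.2 (h1.1 h)

theorem core [Countable I] (hI : IsRandomOrderedGraph I)
    (K : Set (Bundled.{0} (L1.sum Language.order).Structure))
    (hK : ∀ i, (L1.sum Language.order).age (M i) = K)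
    (hKRP : RamseyClass (L1.sum Language.order) K)
    {A B : Type} [(langSD L1 langGr).Structure A] [(langSD L1 langGr).Structure B]
    [Finite A] [Finite B]
    (α : A ↪[langSD L1 langGr] Σₗ i, M i) (β : B ↪[langSD L1 langGr] Σₗ i, M i)
    (z : Σ i, M i) (k : ℕ) (hk : 1 ≤ k) :
    ∃ S : Set (Σₗ i, M i), S.Finite ∧ ∀ c : (A → Σ i, M i) → Fin k,
      ∃ F : B ↪[langSD L1 langGr] Σₗ i, M i, Set.range F ⊆ S ∧
        ∃ col, ∀ g : A ↪[langSD L1 langGr] B, c (fun a => ofLex (F (g a))) = col := by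
  classical
  haveI : Nonempty (Fin k) := ⟨⟨0, hk⟩⟩
  have hnull := nullary_agree (M := M) K hK
  letI iA := fun t => fibStr (L1 := L1) (fun a : A => idx α a = t)
  letI iB := fun t => fibStr (L1 := L1) (fun b : B => idx β b = t)
  have hKM : ∀ C ∈ K, ∀ i, Finite C ∧ Nonempty (C ↪[L1.sum Language.order] M i) := by
    intro C hC i
    rw [← hK i] at hC
    exact ⟨hC.1.finite, hC.2⟩
  have hrig : ∀ A C : Bundled.{0} (L1.sum Language.order).Structure, A ∈ K → C ∈ K →
      ∀ f g : A ↪[L1.sum Language.order] C, Set.range f = Set.range g → (f : A → C) = g := by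
    intro A C hA hC
    rw [← hK z.1] at hA hC
    exact rigid A C hA hC
  have hAK : ∀ t, (⟨{a // idx α a = t}, iA t⟩ : Bundled.{0} (L1.sum Language.order).Structure) ∈ K := by
    intro t
    rw [← hK t.1]
    refine ⟨Structure.FG.of_finite, fib_embed hnull α _ t.1 ?_⟩
    intro a ha
    exact congrArg Subtype.val ha
  -- the fibres of `B` inside one structure of the class
  have hBe : ∀ t, Nonempty ({b // idx β b = t} ↪[L1.sum Language.order] M z.1) := by
    intro t
    have : (⟨{b // idx β b = t}, iB t⟩ : Bundled.{0} (L1.sum Language.order).Structure) ∈ K := by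
      rw [← hK t.1]
      refine ⟨Structure.FG.of_finite, fib_embed hnull β _ t.1 ?_⟩
      intro a ha
      exact congrArg Subtype.val ha
    exact (hKM _ this z.1).2
  have e := fun t => (hBe t).some
  let j0 : B → M z.1 := fun b => e (idx β b) ⟨b, rfl⟩
  have hj0 : ∀ t (b : {b // idx β b = t}), e t b = j0 b.1 := by
    rintro _ ⟨b, rfl⟩
    rfl
  let N := Substructure.closure (L1.sum Language.order) (Set.range j0)
  let D : Bundled.{0} (L1.sum Language.order).Structure := Bundled.of N
  have hD : D ∈ K := by
    rw [← hK z.1]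
    exact closure_mem_age _ (Set.finite_range _)
  let j : B → D := fun b => (⟨j0 b, Substructure.subset_closure ⟨b, rfl⟩⟩ : N)
  have hj : FibEmb (L1.sum Language.order) (idx β) j := by
    intro t
    refine ⟨(e t).codRestrict N (fun b => ?_), fun b => ?_⟩
    · rw [hj0]
      exact Substructure.subset_closure ⟨_, rfl⟩
    · apply Subtype.ext
      exact hj0 t b
  -- the index graph
  have hTA : Finite {i : I // ∃ a, (ofLex (α a)).1 = i} :=
    Finite.of_surjective (idx α) (by rintro ⟨_, a, rfl⟩; exact ⟨a, rfl⟩)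
  have hTB : Finite {i : I // ∃ a, (ofLex (β a)).1 = i} :=
    Finite.of_surjective (idx β) (by rintro ⟨_, a, rfl⟩; exact ⟨a, rfl⟩)
  obtain ⟨P, _, R, hP, hRs, hRi, hR⟩ := ordered_graph_ramsey (κ := Fin k)
    {i : I // ∃ a, (ofLex (α a)).1 = i} {i : I // ∃ a, (ofLex (β a)).1 = i}
    (fun s t => adjI s.1 t.1) (fun s t => (graph_facts I hI s.1 t.1).2)
    (fun s t => adjI s.1 t.1) (fun s t => (graph_facts I hI s.1 t.1).2)
    (fun s => (graph_facts I hI s.1 s.1).1)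
  obtain ⟨η, hη, hηR⟩ := graph_universal I hI P R hRs hRi
  let H : Finset I := (Set.finite_range η).toFinset
  have hH : ∀ p, η p ∈ H := fun p => by simp [H]
  obtain ⟨S, hS, hSc⟩ := fiber_ramsey hKRP hrig M hKM (idx α) hAK D hD z H (Fin k)
  refine ⟨⋃ h ∈ H, (fun m => (toLex ⟨h, m⟩ : Σₗ i, M i)) '' S h, ?_, ?_⟩
  · exact H.finite_toSet.biUnion fun h _ => (hS h).image _
  intro c
  obtain ⟨δ, hδS, hδ⟩ := hSc c
  have fin : ∀ f : {i : I // ∃ a, (ofLex (β a)).1 = i} → P, StrictMono f →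
      (∀ x y, R (f x) (f y) ↔ adjI x.1 y.1) →
      ∃ F : B ↪[langSD L1 langGr] Σₗ i, M i,
        Set.range F ⊆ ⋃ h ∈ H, (fun m => (toLex ⟨h, m⟩ : Σₗ i, M i)) '' S h ∧
        ∀ b, F b = toLex ⟨η (f (idx β b)), δ _ (j b)⟩ := by
    intro f hf hfR
    obtain ⟨F, hF⟩ := build_emb hnull β D j hj (fun t => η (f t)) (hη.comp hf)
      (fun s t => (hηR _ _).trans (hfR s t)) δ
    refine ⟨F, ?_, hF⟩
    rintro _ ⟨b, rfl⟩
    rw [hF]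
    simp only [Set.mem_iUnion]
    exact ⟨_, hH _, _, hδS _ ⟨_, rfl⟩, rfl⟩
  have hcomp : ∀ g : A ↪[langSD L1 langGr] B,
      FibEmb (L1.sum Language.order) (idx α) (j ∘ g) := by
    intro g
    obtain ⟨u, -, -, hu⟩ := induced_map α β g
    exact fibEmb_comp (idx α) (idx β) g u hu D j hj
  by_cases hx0 : ∃ x0 : A → D, FibEmb (L1.sum Language.order) (idx α) x0
  swap
  · obtain ⟨f, hf, hfR, -⟩ := hR (fun _ => Classical.arbitrary _)
    obtain ⟨F, hFS, -⟩ := fin f hf hfR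
    exact ⟨F, hFS, Classical.arbitrary _, fun g => absurd ⟨_, hcomp g⟩ hx0⟩
  obtain ⟨x0, hx0⟩ := hx0
  obtain ⟨f, hf, hfR, col, hcol⟩ := hR
    (fun u => c (mkMap (idx α) z H (fun t => η (u t)) (fun i => δ i) x0))
  obtain ⟨F, hFS, hF⟩ := fin f hf hfR
  refine ⟨F, hFS, col, fun g => ?_⟩
  obtain ⟨u, hu1, hu2, hu⟩ := induced_map α β g
  rw [← hcol u hu1 hu2]
  have hinj : Function.Injective (fun t => η (f (u t))) :=
    (hη.comp (hf.comp hu1)).injective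
  have h1 := hδ (fun t => η (f (u t))) (fun s t hst _ => hinj hst) (j ∘ g) x0 (hcomp g) hx0
  refine Eq.trans (congrArg c ?_) h1
  funext a
  rw [hF, mkMap, if_pos (hH _)]
  show (⟨η (f (idx β (g a))), δ _ (j (g a))⟩ : Σ i, M i) = ⟨η (f (u (idx α a))), δ _ (j (g a))⟩
  rw [hu a]

theorem main [Countable I] (hI : IsRandomOrderedGraph I)
    (K : Set (Bundled.{0} (L1.sum Language.order).Structure))
    (hK : ∀ i, (L1.sum Language.order).age (M i) = K)
    (hKRP : RamseyClass (L1.sum Language.order) K) :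
    RamseyClass (langSD L1 langGr) ((langSD L1 langGr).age (Σₗ i, M i)) := by
  intro A B hA hB k hk
  obtain ⟨hAf, ⟨α⟩⟩ := id hA
  obtain ⟨hBf, ⟨β⟩⟩ := id hB
  have hAf' : Finite A := hAf.finite
  have hBf' : Finite B := hBf.finite
  by_cases hX : IsEmpty (Σₗ i, M i)
  · refine ⟨B, hB, fun c => ⟨⊤, ⟨Substructure.topEquiv.symm⟩, ?_⟩⟩
    intro A₁ A₂ _ _ _ _
    have : A₁ = A₂ := by
      ext x
      exact (hX.false (β x)).elim
    rw [this]
  obtain ⟨z⟩ := not_isEmpty_iff.1 hX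
  obtain ⟨S, hS, hSc⟩ := core hI K hK hKRP α β (ofLex z) k hk
  let N := Substructure.closure (langSD L1 langGr) S
  refine ⟨Bundled.of N, closure_mem_age S hS, fun c => ?_⟩
  change (langSD L1 langGr).Substructure N → Fin k at c
  show ∃ B' : (langSD L1 langGr).Substructure N, _ ∧
    ∀ A₁ A₂ : (langSD L1 langGr).Substructure N, _
  obtain ⟨F, hFS, col, hcol⟩ := hSc (fun w =>
    c (Substructure.closure (langSD L1 langGr) {q : N | ∃ a, q.1 = toLex (w a)}))
  let F' : B ↪[langSD L1 langGr] N :=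
    F.codRestrict N (fun b => Substructure.subset_closure (hFS ⟨b, rfl⟩))
  refine ⟨F'.toHom.range, ⟨F'.equivRange⟩, ?_⟩
  have key : ∀ A₁ : (langSD L1 langGr).Substructure N, A₁ ≤ F'.toHom.range →
      Nonempty (A ≃[langSD L1 langGr] A₁) → c A₁ = col := by
    rintro A₁ h₁ ⟨φ⟩
    let g : A ↪[langSD L1 langGr] B :=
      F'.equivRange.symm.toEmbedding.comp ((Substructure.inclusion h₁).comp φ.toEmbedding)
    have hg : ∀ a, F' (g a) = (φ a).1 := by
      intro a
      have := F'.equivRange.apply_symm_apply (Substructure.inclusion h₁ (φ a))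
      exact congrArg Subtype.val this
    rw [← hcol g]
    congr 1
    apply SetLike.coe_injective
    rw [Substructure.closure_eq_of_isRelational]
    ext q
    constructor
    · intro hq
      refine ⟨φ.symm ⟨q, hq⟩, ?_⟩
      have := hg (φ.symm ⟨q, hq⟩)
      rw [φ.apply_symm_apply] at this
      exact (congrArg Subtype.val this).symm
    · rintro ⟨a, ha⟩
      have : q = (φ a).1 := by
        rw [← hg]
        exact Subtype.ext ha
      rw [this]
      exact (φ a).2
  intro A₁ A₂ h₁ h₂ e₁ e₂
  rw [key A₁ h₁ e₁, key A₂ h₂ e₂]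

end Main

end SRAux

open SRPaper in
/-- If the index structure `𝓘` is a random ordered graph and the common
age `K` of the fibers `M_i` has the Ramsey property, then `R(M_i | i ∈ 𝓘) = 𝓘_{i ∈ I}(M_i)`
has the Ramsey property. -/
theorem statement15 (I : Type) [langGr.Structure I] [LinearOrder I] [Countable I]
    (hI : IsRandomOrderedGraph I)
    (L1 : Language) [L1.IsRelational] (M : I → Type)
    [∀ i, L1.Structure (M i)] [∀ i, LinearOrder (M i)] [∀ i, Countable (M i)]
    (K : Set (CategoryTheory.Bundled (L1.sum Language.order).Structure))
    (hK : ∀ i, (L1.sum Language.order).age (M i) = K)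
    (hKRP : RamseyClass (L1.sum Language.order) K) :
    RamseyClass (langSD L1 langGr) ((langSD L1 langGr).age (Σₗ i, M i)) := by
  exact SRAux.main hI K hK hKRP
end
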